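/- A is Koszul (i.e., all its Koszul complexes are exact) if and only if, for every ρ ≥ 1, the homology of the weight-ρ subcomplex B̄(A)^{(ρ)} of the reduced bar complex is concentrated in homological degree ρ, where it equals A^¡_ρ; equivalently, for every ρ the inclusion of A^¡_ρ, placed in homological degree ρ, into B̄(A)^{(ρ)} is a quasi-isomorphism. -/

import Mathlib

set_option linter.unusedSectionVars false

open TensorProduct

noncomputable section Quadratic

variable (k : Type) [Field k] [CharZero k]
variable (V : Type) [AddCommGroup V] [Module k V]

/-- Iterated tensor powers of `V`: `TP k V n = V^{⊗n}` (with `TP k V 0 = k`, `TP k V 1 = V`). -/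
def TP : ℕ → ModuleCat k
  | 0 => ModuleCat.of k k
  | 1 => ModuleCat.of k V
  | (n + 2) => ModuleCat.of k (↥(TP (n + 1)) ⊗[k] V)

/-- `V^{⊗n} ⊗ V ≅ V^{⊗(n+1)}`. -/
def stepEquiv : ∀ n : ℕ, (↥(TP k V n) ⊗[k] V) ≃ₗ[k] ↥(TP k V (n + 1))
  | 0 => TensorProduct.lid k V
  | (n + 1) => LinearEquiv.refl k ↥(TP k V (n + 2))

/-- The concatenation isomorphism `V^{⊗p} ⊗ V^{⊗q} ≅ V^{⊗(p+q)}`. -/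
def concatEquiv : ∀ p q : ℕ, (↥(TP k V p) ⊗[k] ↥(TP k V q)) ≃ₗ[k] ↥(TP k V (p + q))
  | p, 0 => TensorProduct.rid k ↥(TP k V p)
  | p, 1 => stepEquiv k V p
  | p, (q + 2) =>
      (TensorProduct.assoc k ↥(TP k V p) ↥(TP k V (q + 1)) V).symm.trans
        ((TensorProduct.congr (concatEquiv p (q + 1)) (LinearEquiv.refl k V)).trans
          (stepEquiv k V (p + (q + 1))))

/-- Transport of submodules along an equality of tensor-power indices. -/
def castTP {m n : ℕ} (h : m = n) (S : Submodule k ↥(TP k V m)) : Submodule k ↥(TP k V n) :=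
  h ▸ S

/-- For `S ⊆ V^{⊗p}` and `T ⊆ V^{⊗q}`, the subspace `S ⊗ T ⊆ V^{⊗(p+q)}`. -/
def concatSub {p q : ℕ} (S : Submodule k ↥(TP k V p)) (T : Submodule k ↥(TP k V q)) :
    Submodule k ↥(TP k V (p + q)) :=
  Submodule.map (concatEquiv k V p q).toLinearMap
    (LinearMap.range (TensorProduct.map S.subtype T.subtype))

variable (R : Submodule k ↥(TP k V 2))

/-- The subspace `V^{⊗i} ⊗ R ⊗ V^{⊗j}` of `V^{⊗(i+2+j)}`. -/
def relTerm (i j : ℕ) : Submodule k ↥(TP k V (i + 2 + j)) :=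
  castTP k V (by omega)
    (concatSub k V (⊤ : Submodule k ↥(TP k V i)) (concatSub k V R (⊤ : Submodule k ↥(TP k V j))))

/-- The weight-`d` part `Σ_{i=0}^{d−2} V^{⊗i} ⊗ R ⊗ V^{⊗(d−2−i)}` of the ideal generated by `R`,
so that the weight-`d` piece of the quadratic algebra `A = T(V)/(R)` is `A_d = V^{⊗d}/RelOf d`. -/
def RelOf (d : ℕ) : Submodule k ↥(TP k V d) :=
  ⨆ i : Fin (d - 1), castTP k V (by have := i.isLt; omega) (relTerm k V R i (d - 2 - i))

/-- The weight-`d` component of the Koszul dual of `A = T(V)/(R)`: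
`A^¡_0 = k`, `A^¡_1 = V` and `A^¡_d = ⋂_{i=0}^{d−2} V^{⊗i} ⊗ R ⊗ V^{⊗(d−2−i)}` for `d ≥ 2`. -/
def Dual (d : ℕ) : Submodule k ↥(TP k V d) :=
  ⨅ i : Fin (d - 1), castTP k V (by have := i.isLt; omega) (relTerm k V R i (d - 2 - i))

/-- The numerator `A^¡_d ⊗ V^{⊗(ρ−d)}` of the `d`-th term of the Koszul complex of weight `ρ`
(the `d`-th term of the Koszul complex is `A^¡_d ⊗ A_{ρ−d} = Kt ρ d / Kr ρ d`, with all terms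
realized as subquotients of `V^{⊗ρ}` along the canonical identifications; the differentials are
then all induced by the identity of `V^{⊗ρ}`). -/
def Kt (ρ d : ℕ) : Submodule k ↥(TP k V ρ) :=
  if h : d ≤ ρ then
    castTP k V (by omega) (concatSub k V (Dual k V R d) (⊤ : Submodule k ↥(TP k V (ρ - d))))
  else ⊥

/-- The denominator `A^¡_d ⊗ (RelOf (ρ−d))` of the `d`-th term of the Koszul complex of weight
`ρ`, so that this term is `A^¡_d ⊗ A_{ρ−d} = Kt ρ d / Kr ρ d`. -/
def Kr (ρ d : ℕ) : Submodule k ↥(TP k V ρ) :=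
  if h : d ≤ ρ then
    castTP k V (by omega) (concatSub k V (Dual k V R d) (RelOf k V R (ρ - d)))
  else ⊥

/-- `A = T(V)/(R)` is Koszul: for every weight `ρ ≥ 1` the Koszul complex
`0 → A^¡_ρ → A^¡_{ρ−1} ⊗ A_1 → ⋯ → A^¡_1 ⊗ A_{ρ−1} → A_ρ → 0`
is exact.  Realizing the `d`-th term as the subquotient `Kt ρ d / Kr ρ d` of `V^{⊗ρ}` (with the
differentials induced by the identity of `V^{⊗ρ}`), exactness at the `d`-th term reads
`Kt ρ d ⊓ Kr ρ (d−1) = Kr ρ d ⊔ Kt ρ (d+1)` (at `d = 0` the kernel of the outgoing map is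
everything, whence the `if`). -/
def IsKoszul : Prop :=
  ∀ ρ ≥ 1, ∀ d ≤ ρ,
    Kt k V R ρ d ⊓ (if d = 0 then ⊤ else Kr k V R ρ (d - 1)) =
      Kr k V R ρ d ⊔ Kt k V R ρ (d + 1)

/-! ### The weight-graded pieces of the reduced bar complex of `A = T(V)/(R)`

The weight-`ρ` subcomplex `B̄(A)^{(ρ)}` of the reduced bar complex has, in homological degree
`s`, the module `⊕_c A_{c₁} ⊗ ⋯ ⊗ A_{c_s}`, the sum being over the compositions
`c = (c₁, …, c_s)` of `ρ` into `s` positive parts.  Each summand is canonically the quotient of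
`V^{⊗ρ}` by the subspace `Qden c`, and under these identifications the bar differential `b'`
(which multiplies two adjacent tensor factors) is induced, summand to summand, by `±` the
identity of `V^{⊗ρ}`.  We realize `B̄(A)^{(ρ)}` accordingly: the total space of representatives
is `⊕_c V^{⊗ρ}` (over all compositions `c` of `ρ`), the denominator is the submodule `barN`, the
bar differential is `barD` and the homological degree-`s` layer is `barL ρ s`. -/

open DirectSum

/-- Compositions of `ρ` (lists of positive integers with sum `ρ`). -/
abbrev CompIdx (ρ : ℕ) : Type := {c : List ℕ // (∀ d ∈ c, 1 ≤ d) ∧ c.sum = ρ}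

/-- Merging the entries `i` and `i+1` of a list. -/
def mergeList (c : List ℕ) (i : ℕ) : List ℕ :=
  c.take i ++ (c.getD i 0 + c.getD (i + 1) 0) :: c.drop (i + 2)

theorem mergeList_pos {c : List ℕ} (hc : ∀ d ∈ c, 1 ≤ d) {i : ℕ} (hi : i + 1 < c.length) :
    ∀ d ∈ mergeList c i, 1 ≤ d := by
  intro d hd
  simp only [mergeList, List.mem_append, List.mem_cons] at hd
  rcases hd with h | h | h
  · exact hc d (List.mem_of_mem_take h)
  · have h1 : i < c.length := by omega
    have := hc _ (List.getElem_mem h1)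
    rw [h, List.getD_eq_getElem c 0 h1]
    omega
  · exact hc d (List.mem_of_mem_drop h)

theorem mergeList_sum {c : List ℕ} {i : ℕ} (hi : i + 1 < c.length) :
    (mergeList c i).sum = c.sum := by
  have h1 : i < c.length := by omega
  conv_rhs => rw [← List.take_append_drop i c]
  rw [List.sum_append, List.drop_eq_getElem_cons h1, List.sum_cons,
    List.drop_eq_getElem_cons hi, List.sum_cons]
  simp only [mergeList, List.sum_append, List.sum_cons,
    List.getD_eq_getElem c 0 h1, List.getD_eq_getElem c 0 hi,
    show i + 1 + 1 = i + 2 from rfl]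
  omega

/-- Merging two adjacent parts of a composition of `ρ` gives a composition of `ρ`. -/
def mergeIdx {ρ : ℕ} (c : CompIdx ρ) (i : Fin (c.1.length - 1)) : CompIdx ρ :=
  ⟨mergeList c.1 i, mergeList_pos c.2.1 (by have := i.isLt; omega),
    by rw [mergeList_sum (by have := i.isLt; omega)]; exact c.2.2⟩

/-- The bar differential on representatives: on the summand indexed by the composition `c` it is
`Σ_i (−1)^{i} ·` (identity of `V^{⊗ρ}`) into the summand indexed by `c` with its entries `i` and
`i+1` merged (multiplication `A_{c_i} ⊗ A_{c_{i+1}} → A_{c_i + c_{i+1}}` is induced by the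
identity on representatives). -/
def barD (ρ : ℕ) :
    (⨁ _c : CompIdx ρ, ↥(TP k V ρ)) →ₗ[k] (⨁ _c : CompIdx ρ, ↥(TP k V ρ)) :=
  DirectSum.toModule k _ _ fun c =>
    ∑ i : Fin (c.1.length - 1), ((-1 : k) ^ (i : ℕ)) •
      DirectSum.lof k (CompIdx ρ) (fun _ => ↥(TP k V ρ)) (mergeIdx c i)

/-- For a composition `c = (c₁, …, c_s)` of `ρ`, the kernel of
`V^{⊗ρ} → A_{c₁} ⊗ ⋯ ⊗ A_{c_s}`, namely `Σ_t V^{⊗(c₁+⋯+c_{t-1})} ⊗ Rel_{c_t} ⊗ V^{⊗rest}`. -/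
def Qden : (c : List ℕ) → Submodule k ↥(TP k V c.sum)
  | [] => ⊥
  | (d :: c) =>
      castTP k V (List.sum_cons (a := d) (l := c)).symm
        (concatSub k V (RelOf k V R d) (⊤ : Submodule k ↥(TP k V c.sum)) ⊔
          concatSub k V (⊤ : Submodule k ↥(TP k V d)) (Qden c))

/-- The total denominator: the weight-`ρ` part of the reduced bar complex of `A` is the quotient
of `⊕_c V^{⊗ρ}` by `barN ρ`. -/
def barN (ρ : ℕ) : Submodule k (⨁ _c : CompIdx ρ, ↥(TP k V ρ)) :=
  ⨆ c : CompIdx ρ, Submodule.map (DirectSum.lof k (CompIdx ρ) (fun _ => ↥(TP k V ρ)) c)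
    (castTP k V c.2.2 (Qden k V R c.1))

/-- The homological degree-`s` layer: the part of `⊕_c V^{⊗ρ}` indexed by compositions of
length `s`. -/
def barL (ρ s : ℕ) : Submodule k (⨁ _c : CompIdx ρ, ↥(TP k V ρ)) :=
  ⨆ (c : CompIdx ρ) (_ : c.1.length = s),
    Submodule.map (DirectSum.lof k (CompIdx ρ) (fun _ => ↥(TP k V ρ)) c) ⊤

/-- The composition `(1, 1, …, 1)` of `ρ`. -/
def allOnes (ρ : ℕ) : CompIdx ρ :=
  ⟨List.replicate ρ 1, by intro d hd; rw [List.mem_replicate] at hd; omega,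
    by simp [List.sum_replicate]⟩

/-- The top layer `B̄(A)^{(ρ)}_ρ` of the weight-`ρ` bar subcomplex is `V^{⊗ρ}` (the summand of
the composition `(1,…,1)`); `dualTop` is the image of `A^¡_ρ ⊆ V^{⊗ρ}` in it. -/
def dualTop (ρ : ℕ) : Submodule k (⨁ _c : CompIdx ρ, ↥(TP k V ρ)) :=
  Submodule.map (DirectSum.lof k (CompIdx ρ) (fun _ => ↥(TP k V ρ)) (allOnes ρ))
    (Dual k V R ρ)

section Cube

variable {k}
variable {X : Type} [AddCommGroup X] [Module k X] {Y : Type} [AddCommGroup Y] [Module k Y]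
variable {U : Type} [AddCommGroup U] [Module k U]

variable {ι : Type}

/-- Families of elements of `X` indexed by the vertices of a cube whose directions are the entries
of a list. -/
def Cube (X : Type) : List ι → Type
  | [] => X
  | _ :: l => Cube X l × Cube X l

namespace Cube

instance instAddCommGroup : ∀ l : List ι, AddCommGroup (Cube X l)
  | [] => inferInstanceAs (AddCommGroup X)
  | _ :: l =>
    letI := instAddCommGroup l
    inferInstanceAs (AddCommGroup (Cube X l × Cube X l))

instance instModule : ∀ l : List ι, Module k (Cube X l)
  | [] => inferInstanceAs (Module k X)
  | _ :: l =>
    letI := instModule l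
    inferInstanceAs (Module k (Cube X l × Cube X l))

variable (k X) in
/-- The linear identification of a cube with a pair of opposite faces. -/
def split (i : ι) (l : List ι) : Cube X (i :: l) ≃ₗ[k] Cube X l × Cube X l :=
  LinearEquiv.refl k _

variable (k X) in
/-- The cube differential, the sum of `±` the edge maps. -/
def diff : ∀ l : List ι, Cube X l →ₗ[k] Cube X l
  | [] => 0
  | i :: l => (split k X i l).symm.toLinearMap ∘ₗ
      (LinearMap.prod (-(diff l ∘ₗ LinearMap.fst k _ _))
        (LinearMap.fst k _ _ + diff l ∘ₗ LinearMap.snd k _ _)) ∘ₗ (split k X i l).toLinearMap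

variable (k X) in
/-- The inclusion of the initial vertex. -/
def init : ∀ l : List ι, X →ₗ[k] Cube X l
  | [] => LinearMap.id
  | i :: l => (split k X i l).symm.toLinearMap ∘ₗ LinearMap.inl k _ _ ∘ₗ init l

variable (k X) in
/-- The projection to the initial vertex. -/
def first : ∀ l : List ι, Cube X l →ₗ[k] X
  | [] => LinearMap.id
  | i :: l => first l ∘ₗ LinearMap.fst k _ _ ∘ₗ (split k X i l).toLinearMap

/-- Functoriality of cubes. -/
def map (f : X →ₗ[k] Y) : ∀ l : List ι, Cube X l →ₗ[k] Cube Y l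
  | [] => f
  | i :: l => (split k Y i l).symm.toLinearMap ∘ₗ (map f l).prodMap (map f l) ∘ₗ
      (split k X i l).toLinearMap

variable {i : ι} {l : List ι}

/-- The cube with opposite faces `x`, `y`. -/
def mk (x y : Cube X l) : Cube X (i :: l) := (x, y)

theorem exists_mk (c : Cube X (i :: l)) : ∃ x y, c = mk x y := ⟨c.1, c.2, rfl⟩

theorem mk_inj {x y x' y' : Cube X l} :
    (mk x y : Cube X (i :: l)) = mk x' y' ↔ x = x' ∧ y = y' :=
  Prod.mk_inj

@[simp] theorem mk_add (x y x' y' : Cube X l) :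
    (mk x y : Cube X (i :: l)) + mk x' y' = mk (x + x') (y + y') := rfl

@[simp] theorem mk_sub (x y x' y' : Cube X l) :
    (mk x y : Cube X (i :: l)) - mk x' y' = mk (x - x') (y - y') := rfl

@[simp] theorem mk_neg (x y : Cube X l) : -(mk x y : Cube X (i :: l)) = mk (-x) (-y) := rfl

@[simp] theorem mk_smul (a : k) (x y : Cube X l) :
    a • (mk x y : Cube X (i :: l)) = mk (a • x) (a • y) := rfl

theorem mk_zero : (mk (0 : Cube X l) 0 : Cube X (i :: l)) = 0 := rfl

@[simp] theorem diff_mk (x y : Cube X l) :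
    diff k X (i :: l) (mk x y) = mk (-diff k X l x) (x + diff k X l y) := rfl

theorem diff_nil (x : Cube X ([] : List ι)) : diff k X [] x = 0 := rfl

@[simp] theorem init_cons (x : X) : init k X (i :: l) x = mk (init k X l x) 0 := rfl

@[simp] theorem first_mk (x y : Cube X l) :
    first k X (i :: l) (mk x y) = first k X l x := rfl

@[simp] theorem map_mk (f : X →ₗ[k] Y) (x y : Cube X l) :
    map f (i :: l) (mk x y) = mk (map f l x) (map f l y) := rfl

@[simp] theorem first_diff (c : Cube X l) : first k X l (diff k X l c) = 0 := by
  induction l with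
  | nil => rfl
  | cons i l ih =>
    obtain ⟨x, y, rfl⟩ := exists_mk c
    simp [ih]

@[simp] theorem first_init (x : X) : first k X l (init k X l x) = x := by
  induction l with
  | nil => rfl
  | cons i l ih => simp [ih]

@[simp] theorem diff_diff (c : Cube X l) : diff k X l (diff k X l c) = 0 := by
  induction l with
  | nil => rfl
  | cons i l ih =>
    obtain ⟨x, y, rfl⟩ := exists_mk c
    simp [ih, mk_zero]

theorem map_diff (f : X →ₗ[k] Y) (c : Cube X l) :
    map f l (diff k X l c) = diff k Y l (map f l c) := by
  induction l with
  | nil => exact map_zero f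
  | cons i l ih =>
    obtain ⟨x, y, rfl⟩ := exists_mk c
    simp [ih]

theorem map_init (f : X →ₗ[k] Y) (x : X) :
    map f l (init k X l x) = init k Y l (f x) := by
  induction l with
  | nil => rfl
  | cons i l ih => simp [ih]

theorem map_map (g : Y →ₗ[k] U) (f : X →ₗ[k] Y) (c : Cube X l) :
    map g l (map f l c) = map (g ∘ₗ f) l c := by
  induction l with
  | nil => rfl
  | cons i l ih =>
    obtain ⟨x, y, rfl⟩ := exists_mk c
    simp [ih]

theorem map_zero_apply (c : Cube X l) : map (0 : X →ₗ[k] Y) l c = 0 := by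
  induction l with
  | nil => rfl
  | cons i l ih =>
    obtain ⟨x, y, rfl⟩ := exists_mk c
    simp [ih, mk_zero]

theorem map_id_apply (c : Cube X l) : map (LinearMap.id : X →ₗ[k] X) l c = c := by
  induction l with
  | nil => rfl
  | cons i l ih =>
    obtain ⟨x, y, rfl⟩ := exists_mk c
    simp [ih]

theorem finite_map_ne_zero {κ : Type} (f : κ → X →ₗ[k] Y)
    (hf : ∀ x, {j | f j x ≠ 0}.Finite) (c : Cube X l) :
    {j | map (f j) l c ≠ 0}.Finite := by
  induction l with
  | nil => exact hf c
  | cons i l ih =>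
    obtain ⟨x, y, rfl⟩ := exists_mk c
    refine ((ih x).union (ih y)).subset fun j hj => ?_
    by_contra h
    simp only [Set.mem_union, Set.mem_ofPred_eq, not_or, not_not] at h
    exact hj (by rw [map_mk, h.1, h.2, mk_zero])

/-- The denominator of the cube complex attached to a list of subspaces `W i` and a base
subspace `Z`: at the vertex with merged positions `S` it is `Z + Σ_{i ∈ S} W i`. -/
def den (W : ι → Submodule k X) : Submodule k X → ∀ l : List ι, Submodule k (Cube X l)
  | Z, [] => Z
  | Z, i :: l => ((den W Z l).prod (den W (Z ⊔ W i) l)).comap (split k X i l).toLinearMap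

variable {W : ι → Submodule k X} {Z : Submodule k X}

@[simp] theorem mk_mem_den {x y : Cube X l} :
    (mk x y : Cube X (i :: l)) ∈ den W Z (i :: l) ↔
      x ∈ den W Z l ∧ y ∈ den W (Z ⊔ W i) l := Iff.rfl

theorem den_mono {Z' : Submodule k X} (h : Z ≤ Z') : den W Z l ≤ den W Z' l := by
  induction l generalizing Z Z' with
  | nil => exact h
  | cons i l ih =>
    intro c hc
    obtain ⟨x, y, rfl⟩ := exists_mk c
    exact ⟨ih h hc.1, ih (sup_le_sup_right h _) hc.2⟩

theorem first_mem_of_mem_den {c : Cube X l} (hc : c ∈ den W Z l) :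
    first k X l c ∈ Z := by
  induction l with
  | nil => exact hc
  | cons i l ih =>
    obtain ⟨x, y, rfl⟩ := exists_mk c
    exact ih hc.1

theorem init_mem_den {x : X} : init k X l x ∈ den W Z l ↔ x ∈ Z := by
  refine ⟨fun h => by simpa using first_mem_of_mem_den h, fun h => ?_⟩
  induction l with
  | nil => exact h
  | cons i l ih => exact ⟨ih, zero_mem _⟩

theorem diff_init_mem_den {x : X} :
    diff k X l (init k X l x) ∈ den W Z l ↔ ∀ i ∈ l, x ∈ Z ⊔ W i := by
  induction l with
  | nil => simp [diff_nil]
  | cons i l ih =>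
    simp only [init_cons, diff_mk, mk_mem_den, neg_mem_iff, ih, map_zero,
      add_zero, init_mem_den, List.forall_mem_cons]
    exact and_comm

theorem diff_mem_den {c : Cube X l} (hc : c ∈ den W Z l) :
    diff k X l c ∈ den W Z l := by
  induction l generalizing Z with
  | nil => exact zero_mem _
  | cons i l ih =>
    obtain ⟨x, y, rfl⟩ := exists_mk c
    rw [mk_mem_den] at hc
    exact ⟨neg_mem (ih hc.1), add_mem (den_mono le_sup_left hc.1) (ih hc.2)⟩

/-- The cube complex modulo `den W Z l` has no homology away from the initial vertex. -/
def Acyclic (W : ι → Submodule k X) (Z : Submodule k X) (l : List ι) : Prop :=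
  ∀ c : Cube X l, diff k X l c ∈ den W Z l →
    ∃ y x, c - diff k X l y - init k X l x ∈ den W Z l

theorem acyclic_nil : Acyclic W Z [] := fun c _ => ⟨(0 : Cube X ([] : List ι)), c, by
  have : c - diff k X [] 0 - init k X [] c = 0 := by
    rw [map_zero, sub_zero]; exact sub_self (c : X)
  rw [this]; exact zero_mem _⟩

/-- Long exact sequence argument for the cone presentation of the cube complex. -/
theorem acyclic_cons_iff (hQ : Acyclic W Z l) :
    Acyclic W Z (i :: l) ↔ Acyclic W (Z ⊔ W i) l ∧
      ∀ v, (∀ j ∈ l, v ∈ Z ⊔ W i ⊔ W j) → ∃ u, (∀ j ∈ l, u ∈ Z ⊔ W j) ∧ v - u ∈ Z ⊔ W i := by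
  constructor
  · intro hC
    have key : ∀ y : Cube X l, diff k X l y ∈ den W (Z ⊔ W i) l →
        ∃ t u' s, diff k X l (init k X l s) ∈ den W Z l ∧
          y - diff k X l t - diff k X l u' - init k X l s ∈
            den W (Z ⊔ W i) l := by
      intro y hy
      obtain ⟨p, v, hp⟩ := hC (mk 0 y)
        (by simpa only [diff_mk, mk_mem_den, map_zero, neg_zero, zero_add]
          using ⟨zero_mem _, hy⟩)
      obtain ⟨u, u', rfl⟩ := exists_mk p
      simp only [diff_mk, init_cons, mk_sub, mk_mem_den, sub_zero, zero_sub,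
        neg_neg] at hp
      obtain ⟨h1, h2⟩ := hp
      have hv : v ∈ Z := by simpa using first_mem_of_mem_den h1
      have hu : diff k X l u ∈ den W Z l := by
        simpa using add_mem h1 (init_mem_den.2 hv)
      obtain ⟨t, s, hts⟩ := hQ u hu
      refine ⟨t, u', s, ?_, ?_⟩
      · have := sub_mem hu (diff_mem_den hts)
        simpa using this
      · have := add_mem h2 (den_mono (le_sup_left : Z ≤ Z ⊔ W i) hts)
        convert this using 1
        abel
    constructor
    · intro y hy
      obtain ⟨t, u', s, -, h⟩ := key y hy
      exact ⟨t + u', s, by rw [map_add, ← sub_sub]; exact h⟩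
    · intro v hv
      obtain ⟨t, u', s, hs, h⟩ := key _ (diff_init_mem_den.2 hv)
      exact ⟨s, diff_init_mem_den.1 hs, by simpa using first_mem_of_mem_den h⟩
  · rintro ⟨hP, hS⟩ c hc
    obtain ⟨x, y, rfl⟩ := exists_mk c
    simp only [diff_mk, mk_mem_den, neg_mem_iff] at hc
    obtain ⟨u, v, huv⟩ := hQ x hc.1
    have h1 : init k X l v + diff k X l (u + y) ∈ den W (Z ⊔ W i) l := by
      have := sub_mem hc.2 (den_mono (le_sup_left : Z ≤ Z ⊔ W i) huv)
      convert this using 1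
      rw [map_add]
      abel
    have hv : v ∈ Z ⊔ W i := by simpa using first_mem_of_mem_den h1
    have h2 : diff k X l (u + y) ∈ den W (Z ⊔ W i) l := by
      simpa using sub_mem h1 (init_mem_den.2 hv)
    obtain ⟨u', v', h3⟩ := hP _ h2
    have h4 : ∀ j ∈ l, v' ∈ Z ⊔ W i ⊔ W j := by
      apply diff_init_mem_den.1
      have := sub_mem h2 (diff_mem_den h3)
      simpa using this
    obtain ⟨w, hw, hvw⟩ := hS v' h4
    refine ⟨mk (init k X l w - u) u', v, ?_⟩
    simp only [diff_mk, init_cons, mk_sub, mk_mem_den]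
    constructor
    · have := sub_mem huv (neg_mem (diff_init_mem_den.2 hw))
      convert this using 1
      rw [map_sub]
      abel
    · have := add_mem h3 ((init_mem_den (W := W) (l := l)).2 hvw)
      convert this using 1
      rw [map_sub]
      abel

variable (k X) in
/-- Interchange of the first two directions of a cube, with the signs making it commute with the
differentials. -/
def swap (i j : ι) (l : List ι) : Cube X (j :: i :: l) →ₗ[k] Cube X (i :: j :: l) :=
  (((split k X j l).symm.prodCongr (split k X j l).symm).trans
    (split k X i (j :: l)).symm).toLinearMap ∘ₗ
  (LinearMap.prod
    (LinearMap.prod (LinearMap.fst k _ _ ∘ₗ LinearMap.fst k _ _)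
      (-(LinearMap.fst k _ _ ∘ₗ LinearMap.snd k _ _)))
    (LinearMap.prod (-(LinearMap.snd k _ _ ∘ₗ LinearMap.fst k _ _))
      (-(LinearMap.snd k _ _ ∘ₗ LinearMap.snd k _ _)))) ∘ₗ
  ((split k X j (i :: l)).trans
    ((split k X i l).prodCongr (split k X i l))).toLinearMap

theorem swap_mk {i j : ι} (a b c e : Cube X l) :
    swap k X i j l (mk (mk a b) (mk c e)) = mk (mk a (-c)) (mk (-b) (-e)) := rfl

theorem swap_swap (i j : ι) (l : List ι) (c : Cube X (j :: i :: l)) :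
    swap k X j i l (swap k X i j l c) = c := by
  obtain ⟨x, y, rfl⟩ := exists_mk c
  obtain ⟨a, b, rfl⟩ := exists_mk x
  obtain ⟨c, e, rfl⟩ := exists_mk y
  simp only [swap_mk, neg_neg]

/-- Permuting the list of subspaces gives isomorphic cube complexes. -/
theorem exists_equiv_of_perm {l l' : List ι} (h : l.Perm l') :
    ∃ φ : Cube X l ≃ₗ[k] Cube X l',
      (∀ c, φ (diff k X _ c) = diff k X _ (φ c)) ∧
      (∀ x, φ (init k X _ x) = init k X _ x) ∧
      ∀ (W : ι → Submodule k X) (Z : Submodule k X) (c : Cube X l),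
        φ c ∈ den W Z l' ↔ c ∈ den W Z l := by
  induction h with
  | nil => exact ⟨LinearEquiv.refl k _, fun _ => rfl, fun _ => rfl, fun _ _ _ => Iff.rfl⟩
  | @cons i l l' _ ih =>
    obtain ⟨φ, h1, h2, h3⟩ := ih
    have hmk : ∀ x y : Cube X l, ((split k X i l).trans ((φ.prodCongr φ).trans
      (split k X i l').symm)) (mk x y) = mk (φ x) (φ y) := fun x y => rfl
    refine ⟨(split k X i l).trans ((φ.prodCongr φ).trans (split k X i l').symm), ?_, ?_, ?_⟩
    · intro c
      obtain ⟨x, y, rfl⟩ := exists_mk c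
      simp only [diff_mk, hmk, h1, map_neg, map_add]
    · intro x
      simp only [init_cons, hmk, h2, map_zero]
    · intro W Z c
      obtain ⟨x, y, rfl⟩ := exists_mk c
      exact and_congr (h3 W Z x) (h3 W (Z ⊔ W i) y)
  | swap i j l =>
    refine ⟨LinearEquiv.ofLinearMap (swap k X i j l) (swap k X j i l)
      (LinearMap.ext (swap_swap j i l)) (LinearMap.ext (swap_swap i j l)), ?_, ?_, ?_⟩
    · intro c
      obtain ⟨x, y, rfl⟩ := exists_mk c
      obtain ⟨a, b, rfl⟩ := exists_mk x
      obtain ⟨c, e, rfl⟩ := exists_mk y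
      change swap k X i j l _ = diff k X _ (swap k X i j l _)
      simp only [diff_mk, swap_mk, mk_add, mk_neg, map_neg, mk_inj]
      and_intros <;> first | trivial | abel
    · intro x
      change swap k X i j l _ = _
      simp only [init_cons, ← mk_zero, swap_mk, neg_zero]
    · intro W Z c
      obtain ⟨x, y, rfl⟩ := exists_mk c
      obtain ⟨a, b, rfl⟩ := exists_mk x
      obtain ⟨c, e, rfl⟩ := exists_mk y
      change swap k X i j l _ ∈ _ ↔ _
      rw [swap_mk]
      simp only [mk_mem_den, neg_mem_iff, sup_right_comm Z (W i) (W j)]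
      tauto
  | trans _ _ ih₁ ih₂ =>
    obtain ⟨φ, h1, h2, h3⟩ := ih₁
    obtain ⟨ψ, h1', h2', h3'⟩ := ih₂
    exact ⟨φ.trans ψ, fun c => by simp [h1, h1'], fun x => by simp [h2, h2'],
      fun W Z c => (h3' W Z _).trans (h3 W Z c)⟩

theorem Acyclic.perm {l' : List ι} (h : l.Perm l') (hl : Acyclic W Z l) : Acyclic W Z l' := by
  obtain ⟨φ, h1, h2, h3⟩ := exists_equiv_of_perm (k := k) (X := X) h
  intro c hc
  obtain ⟨c, rfl⟩ := φ.surjective c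
  rw [← h1, h3] at hc
  obtain ⟨y, x, hxy⟩ := hl c hc
  refine ⟨φ y, x, ?_⟩
  rwa [← h1, ← h2, ← map_sub, ← map_sub, h3]

/-- Acyclicity is preserved under taking a direct sum of copies of a cube complex, presented by
coordinate maps `f j` with sections `g j`. -/
theorem Acyclic.of_coordinates {κ : Type} [DecidableEq κ] {W' : ι → Submodule k Y}
    {Z' : Submodule k Y} (f : κ → X →ₗ[k] Y) (g : κ → Y →ₗ[k] X)
    (hfg : ∀ i j, f i ∘ₗ g j = if i = j then LinearMap.id else 0)
    (hfin : ∀ x, {j | f j x ≠ 0}.Finite)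
    (hden : ∀ c : Cube X l, c ∈ den W Z l ↔ ∀ j, map (f j) _ c ∈ den W' Z' l)
    (h : Acyclic W' Z' l) : Acyclic W Z l := by
  intro c hc
  have h' : ∀ j, ∃ y x, map (f j) _ c - diff k Y l y - init k Y l x ∈ den W' Z' l :=
    fun j => h _ (by rw [← map_diff]; exact (hden _).1 hc j)
  choose y x hyx using h'
  have hs := finite_map_ne_zero f hfin c
  refine ⟨∑ j ∈ hs.toFinset, map (g j) _ (y j), ∑ j ∈ hs.toFinset, g j (x j), ?_⟩
  rw [hden]
  intro i
  rw [map_sub, map_sub, map_diff, map_init]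
  have e1 : ∀ j, map (f i) l (map (g j) l (y j)) = if i = j then y j else 0 := by
    intro j
    rw [map_map, hfg]
    split_ifs
    · exact map_id_apply _
    · exact map_zero_apply _
  have e2 : ∀ j, f i (g j (x j)) = if i = j then x j else 0 := by
    intro j
    rw [← LinearMap.comp_apply, hfg]
    split_ifs <;> rfl
  simp only [map_sum, e1, e2, Finset.sum_ite_eq]
  split_ifs with hi
  · exact hyx i
  · have : map (f i) l c = 0 := by simpa using hi
    simp [this]

end Cube

end Cube

section Coordinates

variable {k}
variable {X : Type} [AddCommGroup X] [Module k X] {Y : Type} [AddCommGroup Y] [Module k Y]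
variable {κ : Type} [DecidableEq κ]

/-- A presentation of a quotient of `X` as a direct sum of copies of `Y`: coordinate maps `f j`
with compatible sections `g j`. -/
structure IsCoordinates (f : κ → X →ₗ[k] Y) (g : κ → Y →ₗ[k] X) : Prop where
  comp : ∀ i j, f i ∘ₗ g j = if i = j then LinearMap.id else 0
  finite : ∀ x, {j | f j x ≠ 0}.Finite

/-- The vectors all of whose coordinates lie in `S`. -/
def coordinateSub (f : κ → X →ₗ[k] Y) (S : Submodule k Y) : Submodule k X :=
  ⨅ j, S.comap (f j)

theorem mem_coordinateSub {f : κ → X →ₗ[k] Y} {S : Submodule k Y} {x : X} :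
    x ∈ coordinateSub f S ↔ ∀ j, f j x ∈ S := by
  simp [coordinateSub]

theorem coordinateSub_mono {f : κ → X →ₗ[k] Y} {S S' : Submodule k Y} (h : S ≤ S') :
    coordinateSub f S ≤ coordinateSub f S' := fun _ hx =>
  mem_coordinateSub.2 fun j => h (mem_coordinateSub.1 hx j)

variable {f : κ → X →ₗ[k] Y} {g : κ → Y →ₗ[k] X}

theorem IsCoordinates.apply_sum (h : IsCoordinates f g) (s : Finset κ) (a : κ → Y) (i : κ) :
    f i (∑ j ∈ s, g j (a j)) = if i ∈ s then a i else 0 := by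
  have e : ∀ j, f i (g j (a j)) = if i = j then a j else 0 := by
    intro j
    rw [← LinearMap.comp_apply, h.comp]
    split_ifs <;> rfl
  simp only [map_sum, e, Finset.sum_ite_eq]

theorem IsCoordinates.coordinateSub_sup (h : IsCoordinates f g) (S S' : Submodule k Y) :
    coordinateSub f (S ⊔ S') = coordinateSub f S ⊔ coordinateSub f S' := by
  refine le_antisymm (fun x hx => ?_)
    (sup_le (coordinateSub_mono le_sup_left) (coordinateSub_mono le_sup_right))
  have hx' := fun j => Submodule.mem_sup.1 (mem_coordinateSub.1 hx j)
  choose a ha b hb hab using hx'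
  have hs := h.finite x
  refine Submodule.mem_sup.2 ⟨∑ j ∈ hs.toFinset, g j (a j), mem_coordinateSub.2 fun i => ?_,
    x - ∑ j ∈ hs.toFinset, g j (a j), mem_coordinateSub.2 fun i => ?_, by abel⟩
  · rw [h.apply_sum]
    split_ifs
    exacts [ha i, zero_mem _]
  · rw [map_sub, h.apply_sum, ← hab]
    split_ifs with hi
    · simpa using hb i
    · have : a i + b i = 0 := by rw [hab]; simpa using hi
      simp [this]

theorem coordinateSub_iInf {ι : Sort*} (S : ι → Submodule k Y) :
    coordinateSub f (⨅ i, S i) = ⨅ i, coordinateSub f (S i) := by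
  ext x
  simp only [mem_coordinateSub, Submodule.mem_iInf]
  exact forall_comm

theorem IsCoordinates.mem_den_iff (h : IsCoordinates f g) {ι : Type} {W : ι → Submodule k X}
    {W' : ι → Submodule k Y} {l : List ι} {Z : Submodule k X} {Z' : Submodule k Y}
    (hZ : Z = coordinateSub f Z')
    (hW : ∀ i ∈ l, W i ⊔ coordinateSub f ⊥ = coordinateSub f (W' i)) (c : Cube X l) :
    c ∈ Cube.den W Z l ↔ ∀ j, Cube.map (f j) _ c ∈ Cube.den W' Z' l := by
  induction l generalizing Z Z' with
  | nil =>
    subst hZ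
    exact mem_coordinateSub (x := (show X from c))
  | cons i l ih =>
    obtain ⟨x, y, rfl⟩ := Cube.exists_mk c
    have hW' : ∀ i ∈ l, W i ⊔ coordinateSub f ⊥ = coordinateSub f (W' i) :=
      fun j hj => hW j (List.mem_cons_of_mem _ hj)
    have hZi : Z ⊔ W i = coordinateSub f (Z' ⊔ W' i) := by
      rw [h.coordinateSub_sup, ← hZ, ← hW i List.mem_cons_self, sup_comm (W i), ← sup_assoc,
        sup_eq_left.2 (hZ ▸ coordinateSub_mono bot_le : coordinateSub f ⊥ ≤ Z)]
    simp only [Cube.mk_mem_den, Cube.map_mk, ih hZ hW', ih hZi hW', forall_and]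

theorem IsCoordinates.acyclic (h : IsCoordinates f g) {ι : Type} {W : ι → Submodule k X}
    {W' : ι → Submodule k Y} {l : List ι}
    (hW : ∀ i ∈ l, W i ⊔ coordinateSub f ⊥ = coordinateSub f (W' i))
    (hl : Cube.Acyclic W' ⊥ l) : Cube.Acyclic W (coordinateSub f ⊥) l :=
  Cube.Acyclic.of_coordinates f g h.comp h.finite (h.mem_den_iff rfl hW) hl

end Coordinates
section Embedding

/-- `TP k V 0` is the ground field. -/
def zeroEquiv : ↥(TP k V 0) ≃ₗ[k] k := LinearEquiv.refl k k

/-- `TP k V 1` is `V`. -/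
def oneEquiv : ↥(TP k V 1) ≃ₗ[k] V := LinearEquiv.refl k V

/-- The identification of `V` with Mathlib's first tensor power of `V`. -/
def toTensorPowerOne : V ≃ₗ[k] (⨂[k]^1 V) :=
  (PiTensorProduct.subsingletonEquiv (R := k) (s := fun _ : Fin 1 => V) (0 : Fin 1)).symm

/-- The identification of `TP k V n` with Mathlib's tensor power. -/
def toTensorPower : ∀ n : ℕ, ↥(TP k V n) ≃ₗ[k] (⨂[k]^n V)
  | 0 => (zeroEquiv k V).trans TensorPower.algebraMap₀
  | 1 => (oneEquiv k V).trans (toTensorPowerOne k V)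
  | n + 2 => (stepEquiv k V (n + 1)).symm.trans ((TensorProduct.congr (toTensorPower (n + 1))
      (toTensorPowerOne k V)).trans TensorPower.mulEquiv)

/-- The embedding of `V^{⊗n}` in the tensor algebra `⨁ n, V^{⊗n}`. -/
def toTensorAlg (n : ℕ) : ↥(TP k V n) →ₗ[k] ⨁ n, ⨂[k]^n V :=
  DirectSum.lof k ℕ (fun n => ⨂[k]^n V) n ∘ₗ (toTensorPower k V n).toLinearMap

theorem toTensorAlg_injective (n : ℕ) : Function.Injective (toTensorAlg k V n) :=
  (DirectSum.of_injective (β := fun n => ⨂[k]^n V) n).comp (toTensorPower k V n).injective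

theorem toTensorAlg_zero (x : ↥(TP k V 0)) :
    toTensorAlg k V 0 x = algebraMap k (⨁ n, ⨂[k]^n V) (zeroEquiv k V x) := rfl

theorem stepEquiv_zero (x : ↥(TP k V 0)) (v : V) :
    stepEquiv k V 0 (x ⊗ₜ v) = (oneEquiv k V).symm (zeroEquiv k V x • v) := rfl

theorem concatEquiv_zero (p : ℕ) (x : ↥(TP k V p)) (y : ↥(TP k V 0)) :
    concatEquiv k V p 0 (x ⊗ₜ y) = zeroEquiv k V y • x := rfl

theorem concatEquiv_stepEquiv (p q : ℕ) (x : ↥(TP k V p)) (y : ↥(TP k V (q + 1))) (v : V) :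
    concatEquiv k V p (q + 2) (x ⊗ₜ stepEquiv k V (q + 1) (y ⊗ₜ v)) =
      stepEquiv k V (p + (q + 1)) (concatEquiv k V p (q + 1) (x ⊗ₜ y) ⊗ₜ v) := rfl

theorem toTensorAlg_stepEquiv (n : ℕ) (x : ↥(TP k V n)) (v : V) :
    toTensorAlg k V (n + 1) (stepEquiv k V n (x ⊗ₜ v)) =
      toTensorAlg k V n x * toTensorAlg k V 1 ((oneEquiv k V).symm v) := by
  cases n with
  | zero => rw [toTensorAlg_zero, ← Algebra.smul_def, ← map_smul, stepEquiv_zero, map_smul]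
  | succ n =>
    have h : toTensorPower k V (n + 2) (stepEquiv k V (n + 1) (x ⊗ₜ v)) =
      TensorPower.mulEquiv (toTensorPower k V (n + 1) x ⊗ₜ toTensorPowerOne k V v) := by
      simp only [toTensorPower, LinearEquiv.trans_apply]
      erw [LinearEquiv.symm_apply_apply]
      rfl
    change DirectSum.lof k ℕ (fun n => ⨂[k]^n V) _ (toTensorPower k V (n + 2) _) = _
    rw [h]
    exact (DirectSum.of_mul_of (A := fun n => ⨂[k]^n V) (toTensorPower k V (n + 1) x)
      (toTensorPowerOne k V v)).symm

theorem toTensorAlg_concatEquiv (p : ℕ) : ∀ (q : ℕ) (x : ↥(TP k V p)) (y : ↥(TP k V q)),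
    toTensorAlg k V (p + q) (concatEquiv k V p q (x ⊗ₜ y)) =
      toTensorAlg k V p x * toTensorAlg k V q y
  | 0, x, y => by
    rw [concatEquiv_zero, toTensorAlg_zero, map_smul, Algebra.smul_def]
    exact Algebra.commutes _ _
  | 1, x, y => toTensorAlg_stepEquiv k V p x (oneEquiv k V y)
  | q + 2, x, y => by
    obtain ⟨z, rfl⟩ := (stepEquiv k V (q + 1)).surjective y
    induction z with
    | zero => simp
    | add z z' h h' => rw [map_add, tmul_add, map_add, map_add, map_add, mul_add, h, h']
    | tmul y v =>
      rw [concatEquiv_stepEquiv, toTensorAlg_stepEquiv]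
      erw [toTensorAlg_stepEquiv]
      exact (congrArg (· * _) (toTensorAlg_concatEquiv p (q + 1) x y)).trans (mul_assoc _ _ _)

end Embedding
section Image

/-- The image in the tensor algebra of a subspace of `V^{⊗n}`. -/
def emb (n : ℕ) (S : Submodule k ↥(TP k V n)) : Submodule k (⨁ n, ⨂[k]^n V) :=
  S.map (toTensorAlg k V n)

theorem emb_injective (n : ℕ) : Function.Injective (emb k V n) :=
  Submodule.map_injective_of_injective (toTensorAlg_injective k V n)

theorem emb_castTP {m n : ℕ} (h : m = n) (S : Submodule k ↥(TP k V m)) :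
    emb k V n (castTP k V h S) = emb k V m S := by
  subst h; rfl

theorem emb_bot (n : ℕ) : emb k V n ⊥ = ⊥ := Submodule.map_bot _

theorem emb_sup (n : ℕ) (S T : Submodule k ↥(TP k V n)) :
    emb k V n (S ⊔ T) = emb k V n S ⊔ emb k V n T := Submodule.map_sup _ _ _

theorem emb_iSup (n : ℕ) {ι : Sort*} (S : ι → Submodule k ↥(TP k V n)) :
    emb k V n (⨆ i, S i) = ⨆ i, emb k V n (S i) := Submodule.map_iSup _ _

theorem emb_concatSub {p q : ℕ} (S : Submodule k ↥(TP k V p)) (T : Submodule k ↥(TP k V q)) :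
    emb k V (p + q) (concatSub k V S T) = emb k V p S * emb k V q T := by
  rw [emb, concatSub, TensorProduct.range_map_eq_span_tmul, Submodule.map_span, Submodule.map_span]
  apply le_antisymm
  · rw [Submodule.span_le]
    rintro _ ⟨_, ⟨_, ⟨x, y, rfl⟩, rfl⟩, rfl⟩
    have h := toTensorAlg_concatEquiv k V p q (x : ↥(TP k V p)) (y : ↥(TP k V q))
    exact h ▸ Submodule.mul_mem_mul (Submodule.mem_map_of_mem x.2) (Submodule.mem_map_of_mem y.2)
  · rw [Submodule.mul_le]
    rintro _ ⟨x, hx, rfl⟩ _ ⟨y, hy, rfl⟩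
    rw [← toTensorAlg_concatEquiv]
    exact Submodule.subset_span ⟨_, ⟨_, ⟨⟨x, hx⟩, ⟨y, hy⟩, rfl⟩, rfl⟩, rfl⟩

theorem concatSub_top_top (p q : ℕ) :
    concatSub k V (⊤ : Submodule k ↥(TP k V p)) (⊤ : Submodule k ↥(TP k V q)) = ⊤ := by
  rw [concatSub, LinearMap.range_eq_top.2, Submodule.map_top, LinearEquiv.range]
  exact TensorProduct.map_surjective (fun x => ⟨⟨x, trivial⟩, rfl⟩) (fun x => ⟨⟨x, trivial⟩, rfl⟩)

theorem emb_top (n : ℕ) : emb k V n ⊤ = emb k V 1 ⊤ ^ n := by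
  induction n with
  | zero =>
    rw [pow_zero, emb, Submodule.map_top, Submodule.one_eq_range]
    refine le_antisymm ?_ ?_
    · rintro _ ⟨x, rfl⟩
      exact ⟨zeroEquiv k V x, rfl⟩
    · rintro _ ⟨x, rfl⟩
      exact ⟨(zeroEquiv k V).symm x, rfl⟩
  | succ n ih => rw [pow_succ, ← ih, ← emb_concatSub, concatSub_top_top]

end Image

section Relations

/-- The subspace `V^{⊗i} ⊗ R ⊗ V^{⊗(n-2-i)}` of `V^{⊗n}`, for `i + 2 ≤ n`. -/
def relAt (n i : ℕ) : Submodule k ↥(TP k V n) :=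
  if h : i + 2 ≤ n then castTP k V (by omega) (relTerm k V R i (n - 2 - i)) else ⊥

theorem emb_relAt {n i j : ℕ} (h : n = i + 2 + j) :
    emb k V n (relAt k V R n i) = emb k V 1 ⊤ ^ i * (emb k V 2 R * emb k V 1 ⊤ ^ j) := by
  obtain rfl : j = n - 2 - i := by omega
  rw [relAt, dif_pos (by omega), emb_castTP, relTerm, emb_castTP, emb_concatSub, emb_concatSub,
    emb_top k V i, emb_top k V (n - 2 - i)]

theorem RelOf_eq (d : ℕ) : RelOf k V R d = ⨆ (i) (_ : i + 1 < d), relAt k V R d i := by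
  apply le_antisymm
  · refine iSup_le fun i => le_iSup₂_of_le (i : ℕ) (by omega) ?_
    rw [relAt, dif_pos (by omega)]
  · refine iSup₂_le fun i hi => ?_
    rw [relAt, dif_pos (by omega)]
    exact le_iSup (fun i : Fin (d - 1) => castTP k V (by have := i.isLt; omega)
      (relTerm k V R i (d - 2 - i))) ⟨i, by omega⟩

theorem Dual_eq (d : ℕ) : Dual k V R d = ⨅ (i) (_ : i + 1 < d), relAt k V R d i := by
  apply le_antisymm
  · refine le_iInf₂ fun i hi => ?_
    rw [relAt, dif_pos (by omega)]
    exact iInf_le (fun i : Fin (d - 1) => castTP k V (by have := i.isLt; omega)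
      (relTerm k V R i (d - 2 - i))) ⟨i, by omega⟩
  · refine le_iInf fun i => iInf₂_le_of_le (i : ℕ) (by omega) ?_
    rw [relAt, dif_pos (by omega)]

theorem concatSub_relAt_top {p i : ℕ} (q : ℕ) (h : i + 2 ≤ p) :
    concatSub k V (relAt k V R p i) (⊤ : Submodule k ↥(TP k V q)) = relAt k V R (p + q) i := by
  apply emb_injective
  rw [emb_concatSub, emb_relAt k V R (j := p - 2 - i) (by omega),
    emb_relAt k V R (j := p - 2 - i + q) (by omega), emb_top k V q, pow_add]
  simp only [mul_assoc]

theorem concatSub_top_relAt {q i : ℕ} (p : ℕ) (h : i + 2 ≤ q) :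
    concatSub k V (⊤ : Submodule k ↥(TP k V p)) (relAt k V R q i) =
      relAt k V R (p + q) (p + i) := by
  apply emb_injective
  rw [emb_concatSub, emb_relAt k V R (j := q - 2 - i) (by omega),
    emb_relAt k V R (j := q - 2 - i) (by omega), emb_top k V p, pow_add]
  simp only [mul_assoc]

theorem concatSub_top_RelOf (p q : ℕ) :
    concatSub k V (⊤ : Submodule k ↥(TP k V p)) (RelOf k V R q) =
      ⨆ (i) (_ : p ≤ i ∧ i + 1 < p + q), relAt k V R (p + q) i := by
  apply emb_injective
  rw [emb_concatSub, RelOf_eq]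
  simp only [emb_iSup, Submodule.mul_iSup]
  simp only [← emb_concatSub]
  apply le_antisymm
  · refine iSup₂_le fun i hi => le_iSup₂_of_le (p + i) (by omega) ?_
    rw [concatSub_top_relAt k V R p (by omega)]
  · refine iSup₂_le fun i hi => le_iSup₂_of_le (i - p) (by omega) ?_
    rw [concatSub_top_relAt k V R p (by omega), Nat.add_sub_cancel' hi.1]

theorem emb_RelOf_one : emb k V 1 (RelOf k V R 1) = ⊥ := by
  rw [RelOf_eq, emb_iSup]
  simp [emb_bot]

theorem emb_RelOf_succ (a : ℕ) : emb k V (a + 2) (RelOf k V R (a + 2)) =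
    emb k V 2 R * emb k V 1 ⊤ ^ a ⊔ emb k V 1 ⊤ * emb k V (a + 1) (RelOf k V R (a + 1)) := by
  rw [← emb_concatSub k V ⊤ (RelOf k V R (a + 1)), concatSub_top_RelOf, RelOf_eq, add_comm 1,
    ← one_mul (_ * _), ← pow_zero (emb k V 1 ⊤), ← emb_relAt k V R (n := a + 2) (by omega),
    ← emb_sup]
  congr 1
  apply le_antisymm
  · refine iSup₂_le fun i hi => ?_
    rcases Nat.eq_zero_or_pos i with rfl | h
    · exact le_sup_left
    · exact le_sup_of_le_right (le_iSup₂_of_le i (by omega) le_rfl)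
  · exact sup_le (le_iSup₂_of_le 0 (by omega) le_rfl)
      (iSup₂_le fun i hi => le_iSup₂_of_le i (by omega) le_rfl)

theorem emb_Qden_cons (d : ℕ) (c : List ℕ) : emb k V _ (Qden k V R (d :: c)) =
    emb k V d (RelOf k V R d) * emb k V 1 ⊤ ^ c.sum ⊔
      emb k V 1 ⊤ ^ d * emb k V _ (Qden k V R c) := by
  rw [Qden, emb_castTP, emb_sup, emb_concatSub, emb_concatSub,
    emb_top k V c.sum, emb_top k V d]

theorem emb_Qden_one (c : List ℕ) : emb k V _ (Qden k V R (1 :: c)) =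
    emb k V 1 ⊤ * emb k V _ (Qden k V R c) := by
  rw [emb_Qden_cons, emb_RelOf_one, Submodule.bot_mul, bot_sup_eq, pow_one]

theorem emb_Qden_succ (a : ℕ) (c : List ℕ) : emb k V _ (Qden k V R ((a + 2) :: c)) =
    emb k V 2 R * emb k V 1 ⊤ ^ (a + c.sum) ⊔
      emb k V 1 ⊤ * emb k V _ (Qden k V R ((a + 1) :: c)) := by
  rw [emb_Qden_cons, emb_Qden_cons, emb_RelOf_succ, Submodule.sup_mul, Submodule.mul_sup,
    pow_add _ a c.sum, pow_succ' _ (a + 1)]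
  simp only [mul_assoc, sup_assoc]

/-- The sum of `Z` and of the `W i`, for the members `i` of `l` corresponding to the places
inside the blocks of the composition `c`. -/
def blockDen {X ι : Type} [AddCommGroup X] [Module k X] (W : ι → Submodule k X) :
    Submodule k X → List ι → List ℕ → Submodule k X
  | Z, _ :: l, 1 :: c => blockDen W Z l c
  | Z, i :: l, (a + 2) :: c => blockDen W (Z ⊔ W i) l ((a + 1) :: c)
  | Z, _, _ => Z

theorem emb_blockDen {n : ℕ} : ∀ (m s : ℕ) (Z : Submodule k ↥(TP k V n)) (c : List ℕ)
    (_ : ∀ d ∈ c, 1 ≤ d) (_ : c.sum = m + 1) (_ : s + m + 1 = n),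
    emb k V n (blockDen k (relAt k V R n) Z (List.range' s m) c) =
      emb k V n Z ⊔ emb k V 1 ⊤ ^ s * emb k V _ (Qden k V R c)
  | 0, s, Z, c, hc, hm, hn => by
    obtain rfl : c = [1] := by
      match c, hc, hm with
      | [1], _, _ => rfl
      | d :: e :: c, hc, hm =>
        have := hc d (by simp)
        have := hc e (by simp)
        simp at hm
        omega
    rw [emb_Qden_one, Qden, emb_bot, Submodule.mul_bot, Submodule.mul_bot, sup_bot_eq]
    rfl
  | m + 1, s, Z, [], hc, hm, hn => by simp at hm
  | m + 1, s, Z, 0 :: c, hc, hm, hn => by simp at hc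
  | m + 1, s, Z, 1 :: c, hc, hm, hn => by
    rw [List.range'_succ, blockDen, emb_blockDen m (s + 1) Z c
      (fun d hd => hc d (List.mem_cons_of_mem _ hd)) (by simp at hm; omega) (by omega),
      emb_Qden_one, pow_succ, mul_assoc]
  | m + 1, s, Z, (a + 2) :: c, hc, hm, hn => by
    simp only [List.sum_cons] at hm
    rw [List.range'_succ, blockDen, emb_blockDen m (s + 1) (Z ⊔ relAt k V R n s) ((a + 1) :: c)
      (fun d hd => by
        rcases List.mem_cons.1 hd with rfl | hd
        · omega
        · exact hc d (List.mem_cons_of_mem _ hd)) (by simp; omega) (by omega),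
      emb_Qden_succ, emb_sup, emb_relAt k V R (j := a + c.sum) (by omega), Submodule.mul_sup,
      pow_succ, mul_assoc, sup_assoc]

theorem castTP_Qden {m : ℕ} (c : List ℕ) (hc : ∀ d ∈ c, 1 ≤ d) (hm : c.sum = m + 1) :
    castTP k V hm (Qden k V R c) =
      blockDen k (relAt k V R (m + 1)) ⊥ (List.range' 0 m) c := by
  apply emb_injective
  rw [emb_castTP, emb_blockDen k V R m 0 ⊥ c hc hm (by omega), emb_bot, bot_sup_eq, pow_zero,
    one_mul]

end Relations
section TensorSubspaces

variable {k}
variable {P Q X : Type} [AddCommGroup P] [Module k P] [AddCommGroup Q] [Module k Q]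
  [AddCommGroup X] [Module k X]

theorem range_map_mono {S S' : Submodule k P} {T T' : Submodule k Q} (hS : S ≤ S') (hT : T ≤ T') :
    LinearMap.range (TensorProduct.map S.subtype T.subtype) ≤
      LinearMap.range (TensorProduct.map S'.subtype T'.subtype) := by
  rw [TensorProduct.range_map_eq_span_tmul, TensorProduct.range_map_eq_span_tmul]
  refine Submodule.span_mono ?_
  rintro _ ⟨x, y, rfl⟩
  exact ⟨⟨x, hS x.2⟩, ⟨y, hT y.2⟩, rfl⟩

theorem range_map_top_left (T : Submodule k Q) :
    LinearMap.range (TensorProduct.map (⊤ : Submodule k P).subtype T.subtype) =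
      LinearMap.range (T.subtype.lTensor P) := by
  rw [TensorProduct.range_map_eq_span_tmul, LinearMap.lTensor, TensorProduct.range_map_eq_span_tmul]
  congr 1
  ext x
  constructor
  · rintro ⟨p, q, rfl⟩
    exact ⟨p, q, rfl⟩
  · rintro ⟨p, q, rfl⟩
    exact ⟨⟨p, trivial⟩, q, rfl⟩

theorem range_lTensor_subtype (T : Submodule k Q) :
    LinearMap.range (T.subtype.lTensor P) = LinearMap.ker (T.mkQ.lTensor P) :=
  (LinearMap.exact_iff.1 (lTensor_exact P
    (LinearMap.exact_subtype_mkQ T) (Submodule.mkQ_surjective T))).symm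

theorem range_map_eq_inf (S : Submodule k P) (T : Submodule k Q) :
    LinearMap.range (TensorProduct.map S.subtype T.subtype) =
      LinearMap.range (TensorProduct.map S.subtype (⊤ : Submodule k Q).subtype) ⊓
        LinearMap.range (TensorProduct.map (⊤ : Submodule k P).subtype T.subtype) := by
  refine le_antisymm (le_inf (range_map_mono le_rfl le_top) (range_map_mono le_top le_rfl)) ?_
  rintro _ ⟨⟨y, rfl⟩, hy⟩
  rw [range_map_top_left, range_lTensor_subtype, SetLike.mem_coe, LinearMap.mem_ker] at hy
  obtain ⟨z, rfl⟩ : ∃ z, y = (TensorProduct.congr (LinearEquiv.refl k S)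
      Submodule.topEquiv.symm) z := ⟨_, (LinearEquiv.apply_symm_apply _ y).symm⟩
  have e : ∀ z : S ⊗[k] Q, TensorProduct.map S.subtype (⊤ : Submodule k Q).subtype
      (TensorProduct.congr (LinearEquiv.refl k S) Submodule.topEquiv.symm z) =
      S.subtype.rTensor Q z := by
    intro z
    induction z with
    | zero => simp
    | tmul a b => rfl
    | add a b ha hb => rw [map_add, map_add, ha, hb, map_add]
  rw [e] at hy ⊢
  have hz : S.subtype.rTensor _ (T.mkQ.lTensor S z) = 0 := by
    rw [← hy, ← LinearMap.comp_apply, ← LinearMap.comp_apply, LinearMap.rTensor_comp_lTensor,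
      LinearMap.lTensor_comp_rTensor]
  have hz' := (Module.Flat.rTensor_preserves_injective_linearMap (M := Q ⧸ T) S.subtype
    S.injective_subtype) (hz.trans (map_zero _).symm)
  rw [← LinearMap.mem_ker, ← range_lTensor_subtype] at hz'
  obtain ⟨w, rfl⟩ := hz'
  refine ⟨w, ?_⟩
  rw [← LinearMap.comp_apply, LinearMap.rTensor_comp_lTensor]

theorem exists_coordinates (e : P ⊗[k] Q ≃ₗ[k] X) (T : Submodule k Q) :
    ∃ (κ : Type) (_ : DecidableEq κ) (f : κ → X →ₗ[k] P) (g : κ → P →ₗ[k] X),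
      IsCoordinates f g ∧ ∀ S : Submodule k P, coordinateSub f S =
        (LinearMap.range (TensorProduct.map S.subtype (⊤ : Submodule k Q).subtype)).map
            e.toLinearMap ⊔
          (LinearMap.range (TensorProduct.map (⊤ : Submodule k P).subtype T.subtype)).map
            e.toLinearMap := by
  classical
  let b := Module.Basis.ofVectorSpace k (Q ⧸ T)
  choose c hc using fun j => T.mkQ_surjective (b j)
  let F : X →ₗ[k] _ →₀ P := (TensorProduct.equivFinsuppOfBasisRight b).toLinearMap ∘ₗ
    T.mkQ.lTensor P ∘ₗ e.symm.toLinearMap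
  let f := fun j => Finsupp.lapply (R := k) (M := P) j ∘ₗ F
  let g := fun j => e.toLinearMap ∘ₗ (TensorProduct.mk k P Q).flip (c j)
  have hF : ∀ x y j, f j (e (x ⊗ₜ y)) = b.repr (T.mkQ y) j • x := by
    intro x y j
    simp [f, F]
  have h : IsCoordinates f g := by
    refine ⟨fun i j => LinearMap.ext fun x => ?_, fun x => ?_⟩
    · have : (f i ∘ₗ g j) x = f i (e (x ⊗ₜ c j)) := rfl
      rw [this, hF, hc, b.repr_self, Finsupp.single_apply]
      by_cases hij : i = j
      · simp [hij]
      · simp [hij, Ne.symm hij]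
    · exact (F x).hasFiniteSupport
  have hbot : coordinateSub f ⊥ =
      (LinearMap.range (TensorProduct.map (⊤ : Submodule k P).subtype T.subtype)).map
        e.toLinearMap := by
    rw [range_map_top_left, range_lTensor_subtype]
    ext x
    rw [mem_coordinateSub]
    have : (∀ j, f j x ∈ (⊥ : Submodule k P)) ↔ F x = 0 := by
      simp only [Submodule.mem_bot, Finsupp.ext_iff]
      rfl
    rw [this]
    simp only [F, LinearMap.comp_apply, LinearEquiv.coe_coe, LinearEquiv.map_eq_zero_iff]
    constructor
    · exact fun hx => ⟨e.symm x, hx, e.apply_symm_apply x⟩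
    · rintro ⟨y, hy, rfl⟩
      simpa using hy
  refine ⟨_, inferInstance, f, g, h, fun S => le_antisymm (fun x hx => ?_) (sup_le ?_ ?_)⟩
  · have hs := h.finite x
    rw [mem_coordinateSub] at hx
    refine Submodule.mem_sup.2 ⟨∑ j ∈ hs.toFinset, g j (f j x), sum_mem fun j _ => ?_,
      x - ∑ j ∈ hs.toFinset, g j (f j x), hbot ▸ mem_coordinateSub.2 fun i => ?_, by abel⟩
    · exact ⟨_, ⟨⟨f j x, hx j⟩ ⊗ₜ ⟨c j, trivial⟩, rfl⟩, rfl⟩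
    · rw [map_sub, h.apply_sum]
      split_ifs with hi
      · simp
      · simpa using hi
  · rw [Submodule.map_le_iff_le_comap, TensorProduct.range_map_eq_span_tmul, Submodule.span_le]
    rintro _ ⟨x, y, rfl⟩
    refine mem_coordinateSub.2 fun j => ?_
    have := hF x y j
    exact this ▸ S.smul_mem _ x.2
  · rw [← hbot]
    exact coordinateSub_mono bot_le

end TensorSubspaces
section Weight

theorem concatSub_top_bot (p q : ℕ) :
    concatSub k V (⊤ : Submodule k ↥(TP k V p)) (⊥ : Submodule k ↥(TP k V q)) = ⊥ := by
  apply emb_injective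
  rw [emb_concatSub, emb_bot, emb_bot, Submodule.mul_bot]

theorem concatSub_bot_top (p q : ℕ) :
    concatSub k V (⊥ : Submodule k ↥(TP k V p)) (⊤ : Submodule k ↥(TP k V q)) = ⊥ := by
  apply emb_injective
  rw [emb_concatSub, emb_bot, emb_bot, Submodule.bot_mul]

theorem exists_coordinates_concatSub (p q : ℕ) (T : Submodule k ↥(TP k V q)) :
    ∃ (κ : Type) (_ : DecidableEq κ) (f : κ → ↥(TP k V (p + q)) →ₗ[k] ↥(TP k V p))
      (g : κ → ↥(TP k V p) →ₗ[k] ↥(TP k V (p + q))),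
      IsCoordinates f g ∧ ∀ S, coordinateSub f S = concatSub k V S ⊤ ⊔ concatSub k V ⊤ T :=
  exists_coordinates (concatEquiv k V p q) T

/-- The sum of the `relAt n i` with `p ≤ i`. -/
def relSup (n p : ℕ) : Submodule k ↥(TP k V n) :=
  ⨆ (i) (_ : p ≤ i ∧ i + 1 < n), relAt k V R n i

/-- The intersection of the `relAt n i` with `i + 1 < d`. -/
def relInf (n d : ℕ) : Submodule k ↥(TP k V n) := ⨅ (i) (_ : i + 1 < d), relAt k V R n i

theorem concatSub_Dual_top (p q : ℕ) :
    concatSub k V (Dual k V R p) (⊤ : Submodule k ↥(TP k V q)) = relInf k V R (p + q) p := by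
  obtain ⟨κ, _, f, g, -, hS⟩ := exists_coordinates_concatSub k V p q ⊥
  simp only [concatSub_top_bot, sup_bot_eq] at hS
  rw [← hS, Dual_eq, relInf, coordinateSub_iInf]
  simp only [coordinateSub_iInf]
  refine iInf_congr fun i => iInf_congr fun hi => ?_
  rw [hS, concatSub_relAt_top k V R q (by omega)]

theorem concatSub_eq_inf {p q : ℕ} (S : Submodule k ↥(TP k V p)) (T : Submodule k ↥(TP k V q)) :
    concatSub k V S T = concatSub k V S ⊤ ⊓ concatSub k V ⊤ T := by
  rw [concatSub, range_map_eq_inf,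
    Submodule.map_inf _ (concatEquiv k V p q).injective]
  rfl

theorem Kt_eq {n d : ℕ} (h : d ≤ n) : Kt k V R n d = relInf k V R n d := by
  have : ∀ (q : ℕ) (h : d + q = n), castTP k V h (concatSub k V (Dual k V R d) ⊤) =
      relInf k V R n d := by
    rintro q rfl
    exact concatSub_Dual_top k V R d q
  rw [Kt, dif_pos h, this]

theorem Kr_eq {n d : ℕ} (h : d ≤ n) :
    Kr k V R n d = relInf k V R n d ⊓ relSup k V R n d := by
  have : ∀ (q : ℕ) (h : d + q = n), castTP k V h (concatSub k V (Dual k V R d) (RelOf k V R q)) =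
      relInf k V R n d ⊓ relSup k V R n d := by
    rintro q rfl
    change concatSub k V _ _ = _
    rw [concatSub_eq_inf, concatSub_Dual_top, concatSub_top_RelOf, relSup]
  rw [Kr, dif_pos h, this]

theorem exists_coordinates_relSup {n p : ℕ} (h : p ≤ n) :
    ∃ (κ : Type) (_ : DecidableEq κ) (f : κ → ↥(TP k V n) →ₗ[k] ↥(TP k V p))
      (g : κ → ↥(TP k V p) →ₗ[k] ↥(TP k V n)), IsCoordinates f g ∧
      coordinateSub f ⊥ = relSup k V R n p ∧
      (∀ i, i + 1 < p →
        coordinateSub f (relAt k V R p i) = relAt k V R n i ⊔ relSup k V R n p) ∧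
      coordinateSub f (Dual k V R p) = relInf k V R n p ⊔ relSup k V R n p := by
  obtain ⟨q, rfl⟩ := Nat.exists_eq_add_of_le h
  obtain ⟨κ, _, f, g, hfg, hS⟩ := exists_coordinates_concatSub k V p q (RelOf k V R q)
  simp only [concatSub_top_RelOf] at hS
  refine ⟨κ, _, f, g, hfg, ?_, fun i hi => ?_, ?_⟩
  · rw [hS, concatSub_bot_top, bot_sup_eq, relSup]
  · rw [hS, concatSub_relAt_top k V R q (by omega), relSup]
  · rw [hS, concatSub_Dual_top, relSup]

theorem iInf_relAt_sup {n p : ℕ} (h : p ≤ n) :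
    ⨅ (i) (_ : i + 1 < p), (relAt k V R n i ⊔ relSup k V R n p) =
      relInf k V R n p ⊔ relSup k V R n p := by
  obtain ⟨κ, _, f, g, -, -, hr, hd⟩ := exists_coordinates_relSup k V R h
  rw [← hd, Dual_eq, coordinateSub_iInf]
  simp only [coordinateSub_iInf]
  exact iInf_congr fun i => iInf_congr fun hi => (hr i hi).symm

theorem relSup_eq {n p : ℕ} (h : p + 1 < n) :
    relSup k V R n p = relSup k V R n (p + 1) ⊔ relAt k V R n p := by
  apply le_antisymm
  · refine iSup₂_le fun i hi => ?_
    rcases eq_or_lt_of_le hi.1 with rfl | h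
    · exact le_sup_right
    · exact le_sup_of_le_left (le_iSup₂_of_le i ⟨h, hi.2⟩ le_rfl)
  · exact sup_le (iSup₂_le fun i hi => le_iSup₂_of_le i (by omega) le_rfl)
      (le_iSup₂_of_le p (by omega) le_rfl)

theorem relSup_eq_bot {n p : ℕ} (h : n ≤ p + 1) : relSup k V R n p = ⊥ :=
  le_bot_iff.1 (iSup₂_le fun i hi => by omega)

theorem relInf_succ (n p : ℕ) :
    relInf k V R n (p + 2) = relInf k V R n (p + 1) ⊓ relAt k V R n p := by
  apply le_antisymm
  · exact le_inf (le_iInf₂ fun i hi => iInf₂_le i (by omega)) (iInf₂_le p (by omega))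
  · refine le_iInf₂ fun i hi => ?_
    rcases eq_or_ne i p with rfl | h
    · exact inf_le_right
    · exact inf_le_of_left_le (iInf₂_le i (by omega))

theorem relInf_anti (n : ℕ) {p q : ℕ} (h : p ≤ q) : relInf k V R n q ≤ relInf k V R n p :=
  le_iInf₂ fun i _ => iInf₂_le i (by omega)

theorem relInf_eq_top {n p : ℕ} (h : p ≤ 1) : relInf k V R n p = ⊤ :=
  top_le_iff.1 (le_iInf₂ fun i hi => by omega)

/-- Exactness of the Koszul complex of weight `n` at the place `r + 1`. -/
def KoszulAt (n r : ℕ) : Prop :=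
  relInf k V R n (r + 1) ⊓ relSup k V R n r =
    relInf k V R n (r + 1) ⊓ relSup k V R n (r + 1) ⊔ relInf k V R n (r + 2)

theorem isKoszul_iff : IsKoszul k V R ↔ ∀ n r, r + 2 < n → KoszulAt k V R n r := by
  have key : ∀ n r, r + 1 < n →
      ((Kt k V R n (r + 1) ⊓ (if r + 1 = 0 then ⊤ else Kr k V R n (r + 1 - 1)) =
        Kr k V R n (r + 1) ⊔ Kt k V R n (r + 1 + 1)) ↔ KoszulAt k V R n r) := by
    intro n r hr
    rw [if_neg (by omega), Nat.add_sub_cancel, Kt_eq k V R (by omega), Kr_eq k V R (by omega),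
      Kr_eq k V R (by omega), Kt_eq k V R (by omega), ← inf_assoc,
      inf_eq_left.2 (relInf_anti k V R n (Nat.le_succ r)), KoszulAt]
  refine ⟨fun h n r hr => (key n r (by omega)).1 (h n (by omega) (r + 1) (by omega)),
    fun h n hn d hd => ?_⟩
  rcases d with _ | r
  · rw [if_pos rfl, inf_top_eq, Kt_eq k V R hd, Kt_eq k V R (by omega),
      relInf_eq_top k V R zero_le_one, relInf_eq_top k V R le_rfl, sup_top_eq]
  · rcases eq_or_lt_of_le hd with rfl | hd'
    · rw [if_neg (by omega), Nat.add_sub_cancel, Kr_eq k V R (by omega), Kr_eq k V R (by omega),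
        relSup_eq_bot k V R (Nat.le_succ _), relSup_eq_bot k V R le_rfl, Kt_eq k V R le_rfl, Kt,
        dif_neg (by omega)]
      simp
    · rw [key n r hd']
      rcases eq_or_lt_of_le (Nat.succ_le_of_lt hd') with rfl | hd'
      · rw [KoszulAt, relSup_eq k V R (by omega), relSup_eq_bot k V R (by omega), relInf_succ]
        simp
      · exact h n r hd'

end Weight

section Induction

theorem inf_le_iff_inf_eq {α : Type*} [Lattice α] [IsModularLattice α] {a b c d : α}
    (hba : b ≤ a) (hcd : c ≤ d) (hbd : b ≤ d) :
    (a ⊔ c) ⊓ d ≤ b ⊔ c ↔ a ⊓ d = a ⊓ c ⊔ b := by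
  constructor
  · intro h
    apply le_antisymm
    · have : a ⊓ d ≤ (b ⊔ c) ⊓ a :=
        le_inf ((inf_le_inf_right d le_sup_left).trans h) inf_le_left
      rwa [sup_inf_assoc_of_le c hba, inf_comm c, sup_comm] at this
    · exact sup_le (inf_le_inf_left a hcd) (le_inf hba hbd)
  · intro h
    rw [sup_comm, sup_inf_assoc_of_le a hcd, h]
    exact sup_le le_sup_right (sup_le (inf_le_right.trans le_sup_right) le_sup_left)

/-- The cube complex of weight `n` is acyclic. -/
def WeightAcyclic (n : ℕ) : Prop :=
  Cube.Acyclic (relAt k V R n) ⊥ (List.range (n - 1)).reverse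

theorem acyclic_relSup {n p : ℕ} (hp : p + 1 ≤ n) (h : WeightAcyclic k V R (p + 1)) :
    Cube.Acyclic (relAt k V R n) (relSup k V R n (p + 1)) (List.range p).reverse := by
  obtain ⟨κ, _, f, g, hfg, hb, hr, -⟩ := exists_coordinates_relSup k V R hp
  rw [← hb]
  refine hfg.acyclic (fun i hi => ?_) h
  have : i < p := by simpa using hi
  rw [hb, hr i (by omega)]

theorem forall_mem_relAt_sup_iff {n p : ℕ} (h : p + 1 ≤ n) (v : ↥(TP k V n)) :
    (∀ j ∈ (List.range p).reverse, v ∈ relSup k V R n (p + 1) ⊔ relAt k V R n j) ↔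
      v ∈ relInf k V R n (p + 1) ⊔ relSup k V R n (p + 1) := by
  rw [← iInf_relAt_sup k V R h]
  simp [Submodule.mem_iInf, sup_comm]

theorem forall_exists_iff_koszulAt {n r : ℕ} (h : r + 2 < n) :
    (∀ v, (∀ j ∈ (List.range (r + 1)).reverse, v ∈ relSup k V R n (r + 1) ⊔ relAt k V R n j) →
      ∃ u, (∀ j ∈ (List.range (r + 1)).reverse, u ∈ relSup k V R n (r + 2) ⊔ relAt k V R n j) ∧
        v - u ∈ relSup k V R n (r + 1)) ↔ KoszulAt k V R n r := by
  have hs := relSup_eq k V R (show r + 1 < n by omega)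
  have hs' := relSup_eq k V R (show r + 1 + 1 < n by omega)
  have hi := relInf_succ k V R n r
  rw [KoszulAt, ← inf_le_iff_inf_eq (hi ▸ inf_le_left) (hs ▸ le_sup_left)
    (hi ▸ hs ▸ inf_le_right.trans le_sup_right)]
  have hv : ∀ v, (∀ j ∈ (List.range (r + 1)).reverse,
      v ∈ relSup k V R n (r + 1) ⊔ relAt k V R n j) ↔
      v ∈ (relInf k V R n (r + 1) ⊔ relSup k V R n (r + 1)) ⊓ relSup k V R n r := by
    intro v
    rw [List.range_succ, List.reverse_append]
    simp only [List.reverse_singleton, List.singleton_append, List.forall_mem_cons]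
    rw [forall_mem_relAt_sup_iff k V R (by omega), ← hs, Submodule.mem_inf, and_comm]
  simp only [hv, forall_mem_relAt_sup_iff k V R (show r + 1 + 1 ≤ n by omega), SetLike.le_def]
  refine forall₂_congr fun v _ => ⟨?_, fun h => ?_⟩
  · rintro ⟨u, hu, huv⟩
    rw [hs'] at huv ⊢
    have : relInf k V R n (r + 2) ⊔ relSup k V R n (r + 2) ≤ relInf k V R n (r + 2) ⊔
        (relSup k V R n (r + 2) ⊔ relAt k V R n (r + 1)) := sup_le_sup_left le_sup_left _
    exact sub_add_cancel v u ▸ add_mem (le_sup_right (a := relInf k V R n (r + 2)) huv) (this hu)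
  · obtain ⟨u, hu, w, hw, rfl⟩ := Submodule.mem_sup.1 h
    exact ⟨u, le_sup_left (a := relInf k V R n (r + 2)) hu, by simpa using hw⟩

theorem acyclic_relSup_iff {n : ℕ} (hn : ∀ p, p + 1 < n → WeightAcyclic k V R (p + 1)) {p : ℕ}
    (hp : p + 1 ≤ n) : Cube.Acyclic (relAt k V R n) (relSup k V R n p) (List.range p).reverse ↔
      ∀ r, r + 1 < p → KoszulAt k V R n r := by
  induction p with
  | zero => exact ⟨fun _ r hr => by omega, fun _ => Cube.acyclic_nil⟩
  | succ p ih =>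
    have hl : (List.range (p + 1)).reverse = p :: (List.range p).reverse := by
      simp [List.range_succ]
    rw [hl, Cube.acyclic_cons_iff (acyclic_relSup k V R (by omega) (hn p (by omega))),
      ← relSup_eq k V R (by omega), ih (by omega)]
    rcases p with _ | r
    · simp only [List.range_zero, List.reverse_nil, List.not_mem_nil]
      refine ⟨fun _ r hr => by omega, fun _ => ⟨fun r hr => by omega, fun v _ => ⟨v, ?_⟩⟩⟩
      simp
    · rw [forall_exists_iff_koszulAt k V R (by omega)]
      refine ⟨fun h q hq => ?_, fun h => ⟨fun q hq => h q (by omega), h r (by omega)⟩⟩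
      rcases eq_or_ne q r with rfl | hqr
      · exact h.2
      · exact h.1 q (by omega)

theorem isKoszul_iff_weightAcyclic :
    IsKoszul k V R ↔ ∀ m, WeightAcyclic k V R (m + 1) := by
  have key : ∀ m, (∀ p, p + 1 < m + 1 → WeightAcyclic k V R (p + 1)) →
      (WeightAcyclic k V R (m + 1) ↔ ∀ r, r + 1 < m → KoszulAt k V R (m + 1) r) := by
    intro m hm
    rw [← acyclic_relSup_iff k V R hm le_rfl, relSup_eq_bot k V R le_rfl, WeightAcyclic,
      Nat.add_sub_cancel]
  rw [isKoszul_iff]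
  constructor
  · intro h m
    induction m using Nat.strong_induction_on with
    | _ m ih => exact (key m fun p hp => ih p (by omega)).2 fun r hr => h _ r (by omega)
  · intro h n r hr
    obtain ⟨m, rfl⟩ : ∃ m, n = m + 1 := ⟨n - 1, by omega⟩
    exact (key m fun p _ => h p).1 (h m) r (by omega)

end Induction
section Compositions

theorem isComp_cases {n : ℕ} {c : List ℕ} (hc : (∀ d ∈ c, 1 ≤ d) ∧ c.sum = n + 2) :
    (∃ c', c = 1 :: c' ∧ (∀ d ∈ c', 1 ≤ d) ∧ c'.sum = n + 1) ∨
      ∃ a c', c = (a + 2) :: c' ∧ (∀ d ∈ (a + 1) :: c', 1 ≤ d) ∧ ((a + 1) :: c').sum = n + 1 := by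
  match c with
  | [] => simp at hc
  | 0 :: c => simp at hc
  | 1 :: c =>
    refine Or.inl ⟨c, rfl, fun d hd => hc.1 d (List.mem_cons_of_mem _ hd), ?_⟩
    have := hc.2
    rw [List.sum_cons] at this
    omega
  | (a + 2) :: c =>
    refine Or.inr ⟨a, c, rfl, fun d hd => ?_, ?_⟩
    · rcases List.mem_cons.1 hd with rfl | hd
      · omega
      · exact hc.1 d (List.mem_cons_of_mem _ hd)
    · have := hc.2
      rw [List.sum_cons] at this ⊢
      omega

theorem isComp_one_cons {n : ℕ} {c : List ℕ} (hc : (∀ d ∈ c, 1 ≤ d) ∧ c.sum = n + 1) :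
    (∀ d ∈ 1 :: c, 1 ≤ d) ∧ (1 :: c).sum = n + 2 := by
  refine ⟨by simpa using hc.1, ?_⟩
  rw [List.sum_cons, hc.2]
  omega

theorem isComp_succ {n : ℕ} {a : ℕ} {c : List ℕ}
    (hc : (∀ d ∈ (a + 1) :: c, 1 ≤ d) ∧ ((a + 1) :: c).sum = n + 1) :
    (∀ d ∈ (a + 2) :: c, 1 ≤ d) ∧ ((a + 2) :: c).sum = n + 2 := by
  refine ⟨by simpa using hc.1, ?_⟩
  have := hc.2
  rw [List.sum_cons] at this ⊢
  omega

theorem length_le_of_isComp {n : ℕ} {c : List ℕ} (hc : (∀ d ∈ c, 1 ≤ d) ∧ c.sum = n) :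
    c.length ≤ n :=
  hc.2 ▸ List.length_le_sum_of_one_le c hc.1

theorem eq_one_of_sum_le_length {c : List ℕ} (hc : ∀ d ∈ c, 1 ≤ d) (h : c.sum ≤ c.length) :
    ∀ d ∈ c, d = 1 := by
  induction c with
  | nil => simp
  | cons e c ih =>
    rw [List.forall_mem_cons] at hc ⊢
    have := List.length_le_sum_of_one_le c hc.2
    rw [List.sum_cons, List.length_cons] at h
    exact ⟨by omega, ih hc.2 (by omega)⟩

theorem eq_allOnes {n : ℕ} (c : CompIdx n) (h : c.1.length = n) : c = allOnes n := by
  refine Subtype.ext (List.eq_replicate_iff.2 ⟨h, eq_one_of_sum_le_length c.2.1 ?_⟩)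
  rw [c.2.2, h]

theorem length_mergeList {c : List ℕ} {i : ℕ} (hi : i < c.length - 1) :
    (mergeList c i).length + 1 = c.length := by
  simp only [mergeList, List.length_append, List.length_take, List.length_cons, List.length_drop]
  omega

theorem mergeList_cons_succ (d : ℕ) (c : List ℕ) (i : ℕ) :
    mergeList (d :: c) (i + 1) = d :: mergeList c i := rfl

theorem mergeList_cons_zero (d e : ℕ) (c : List ℕ) :
    mergeList (d :: e :: c) 0 = (d + e) :: c := rfl

end Compositions

namespace Cube

variable {k}
variable {X : Type} [AddCommGroup X] [Module k X] {ι : Type}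

variable (k X) in
/-- The inclusion of the vertex of the cube corresponding to a composition `c` of
`l.length + 1`: the merged places are those inside the blocks of `c`. -/
def ins : ∀ (l : List ι) (_ : List ℕ), X →ₗ[k] Cube X l
  | [], _ => LinearMap.id
  | i :: l, 1 :: c => (split k X i l).symm.toLinearMap ∘ₗ LinearMap.inl k _ _ ∘ₗ ins l c
  | i :: l, (a + 2) :: c =>
    (split k X i l).symm.toLinearMap ∘ₗ LinearMap.inr k _ _ ∘ₗ ins l ((a + 1) :: c)
  | _ :: _, _ => 0

variable (k X) in
/-- The projection to the vertex of the cube corresponding to a composition. -/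
def proj : ∀ (l : List ι) (_ : List ℕ), Cube X l →ₗ[k] X
  | [], _ => LinearMap.id
  | i :: l, 1 :: c => proj l c ∘ₗ LinearMap.fst k _ _ ∘ₗ (split k X i l).toLinearMap
  | i :: l, (a + 2) :: c =>
    proj l ((a + 1) :: c) ∘ₗ LinearMap.snd k _ _ ∘ₗ (split k X i l).toLinearMap
  | _ :: _, _ => 0

variable {i : ι} {l : List ι}

theorem ins_one_cons (c : List ℕ) (x : X) :
    ins k X (i :: l) (1 :: c) x = mk (ins k X l c x) 0 := rfl

theorem ins_succ (a : ℕ) (c : List ℕ) (x : X) :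
    ins k X (i :: l) ((a + 2) :: c) x = mk 0 (ins k X l ((a + 1) :: c) x) := rfl

theorem proj_one_cons (c : List ℕ) (x y : Cube X l) :
    proj k X (i :: l) (1 :: c) (mk x y) = proj k X l c x := rfl

theorem proj_succ (a : ℕ) (c : List ℕ) (x y : Cube X l) :
    proj k X (i :: l) ((a + 2) :: c) (mk x y) = proj k X l ((a + 1) :: c) y := rfl

theorem ins_replicate (x : X) : ins k X l (List.replicate (l.length + 1) 1) x = init k X l x := by
  induction l with
  | nil => rfl
  | cons i l ih => rw [List.length_cons, List.replicate_succ, ins_one_cons, ih, init_cons]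

theorem eq_singleton_of_isComp {c : List ℕ} (hc : (∀ d ∈ c, 1 ≤ d) ∧ c.sum = 1) : c = [1] := by
  match c, hc with
  | [], hc => simp at hc
  | [d], hc => simpa using hc.2
  | d :: e :: c, hc =>
    have := hc.1 d (by simp)
    have := hc.1 e (by simp)
    have := hc.2
    simp only [List.sum_cons] at this
    omega

theorem proj_ins {c c' : List ℕ} (hc : (∀ d ∈ c, 1 ≤ d) ∧ c.sum = l.length + 1)
    (hc' : (∀ d ∈ c', 1 ≤ d) ∧ c'.sum = l.length + 1) (x : X) :
    proj k X l c (ins k X l c' x) = if c = c' then x else 0 := by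
  induction l generalizing c c' with
  | nil =>
    rw [eq_singleton_of_isComp hc, eq_singleton_of_isComp hc', if_pos rfl]
    rfl
  | cons i l ih =>
    rcases isComp_cases hc with ⟨c, rfl, hs⟩ | ⟨a, c, rfl, hs⟩ <;>
    rcases isComp_cases hc' with ⟨c', rfl, hs'⟩ | ⟨a', c', rfl, hs'⟩
    · rw [ins_one_cons, proj_one_cons, ih hs hs']
      simp
    · rw [ins_succ, proj_one_cons, if_neg (by simp), map_zero]
    · rw [ins_one_cons, proj_succ, if_neg (by simp), map_zero]
    · rw [ins_succ, proj_succ, ih hs hs']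
      simp

theorem eq_top_of_ins_mem (P : Submodule k (Cube X l))
    (h : ∀ c : List ℕ, (∀ d ∈ c, 1 ≤ d) ∧ c.sum = l.length + 1 → ∀ x, ins k X l c x ∈ P) :
    P = ⊤ := by
  induction l with
  | nil => exact Submodule.eq_top_iff'.2 fun x => h [1] (by simp) x
  | cons i l ih =>
    have h₁ := ih (P.comap ((split k X i l).symm.toLinearMap ∘ₗ LinearMap.inl k _ _))
      fun c hc x => h (1 :: c) (isComp_one_cons hc) x
    have h₂ := ih (P.comap ((split k X i l).symm.toLinearMap ∘ₗ LinearMap.inr k _ _))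
      fun c hc x => by
        match c, hc with
        | [], hc => simp at hc
        | 0 :: c, hc => simp at hc
        | (a + 1) :: c, hc => exact h ((a + 2) :: c) (isComp_succ hc) x
    rw [Submodule.eq_top_iff'] at h₁ h₂ ⊢
    intro c
    obtain ⟨x, y, rfl⟩ := exists_mk c
    have : (mk x y : Cube X (i :: l)) = mk x 0 + mk 0 y := by simp
    exact this ▸ add_mem (h₁ x) (h₂ y)

theorem diff_ins {c : List ℕ} (hc : (∀ d ∈ c, 1 ≤ d) ∧ c.sum = l.length + 1) (x : X) :
    diff k X l (ins k X l c x) =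
      ∑ j ∈ Finset.range (c.length - 1), (-1 : k) ^ j • ins k X l (mergeList c j) x := by
  induction l generalizing c with
  | nil =>
    rw [eq_singleton_of_isComp hc]
    simp [diff_nil]
  | cons i l ih =>
    rcases isComp_cases hc with ⟨c, rfl, hs⟩ | ⟨a, c, rfl, hs⟩
    · match c, hs with
      | [], hs => simp at hs
      | 0 :: c, hs => simp at hs
      | (a + 1) :: c, hs =>
        rw [List.length_cons, List.length_cons, Nat.add_sub_cancel, Finset.sum_range_succ',
          mergeList_cons_zero, show 1 + (a + 1) = a + 2 by omega, ins_succ, ins_one_cons,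
          diff_mk, ih hs]
        have e : ∀ j, (-1 : k) ^ (j + 1) • ins k X (i :: l) (mergeList (1 :: (a + 1) :: c) (j + 1))
            x = (split k X i l).symm (LinearMap.inl k _ _
              (-((-1 : k) ^ j • ins k X l (mergeList ((a + 1) :: c) j) x))) := by
          intro j
          rw [mergeList_cons_succ, ins_one_cons, mk_smul, smul_zero, pow_succ, mul_neg_one, neg_smul]
          rfl
        simp only [e, ← map_sum, Finset.sum_neg_distrib]
        change _ = mk _ 0 + _
        simp
    · have e : ∀ j < c.length, ins k X (i :: l) (mergeList ((a + 2) :: c) j) x =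
          (split k X i l).symm (LinearMap.inr k _ _
            (ins k X l (mergeList ((a + 1) :: c) j) x)) := by
        intro j hj
        match j, c with
        | 0, [] => simp at hj
        | 0, d :: c =>
          rw [mergeList_cons_zero, mergeList_cons_zero, show a + 2 + d = a + d + 2 by omega,
            show a + 1 + d = a + d + 1 by omega]
          rfl
        | j + 1, c => rfl
      have e' : ∑ j ∈ Finset.range c.length, (-1 : k) ^ j •
            ins k X (i :: l) (mergeList ((a + 2) :: c) j) x =
          (split k X i l).symm (LinearMap.inr k _ _ (∑ j ∈ Finset.range c.length, (-1 : k) ^ j •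
            ins k X l (mergeList ((a + 1) :: c) j) x)) := by
        rw [map_sum, map_sum]
        exact Finset.sum_congr rfl fun j hj => by
          rw [e j (Finset.mem_range.1 hj), map_smul, map_smul]
      rw [ins_succ, diff_mk, ih hs, List.length_cons, Nat.add_sub_cancel, List.length_cons,
        Nat.add_sub_cancel, e', map_zero, neg_zero, zero_add]
      rfl

theorem ins_mem_den {W : ι → Submodule k X} {Z : Submodule k X} {c : List ℕ}
    (hc : (∀ d ∈ c, 1 ≤ d) ∧ c.sum = l.length + 1) {x : X} (hx : x ∈ blockDen k W Z l c) :
    ins k X l c x ∈ den W Z l := by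
  induction l generalizing c Z with
  | nil =>
    rw [eq_singleton_of_isComp hc] at hx
    exact hx
  | cons i l ih =>
    rcases isComp_cases hc with ⟨c, rfl, hs⟩ | ⟨a, c, rfl, hs⟩
    · exact ⟨ih hs hx, zero_mem _⟩
    · exact ⟨zero_mem _, ih hs hx⟩

theorem proj_mem_blockDen {W : ι → Submodule k X} {Z : Submodule k X} {c : List ℕ}
    (hc : (∀ d ∈ c, 1 ≤ d) ∧ c.sum = l.length + 1) {x : Cube X l} (hx : x ∈ den W Z l) :
    proj k X l c x ∈ blockDen k W Z l c := by
  induction l generalizing c Z with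
  | nil =>
    rw [eq_singleton_of_isComp hc]
    exact hx
  | cons i l ih =>
    obtain ⟨x, y, rfl⟩ := exists_mk x
    rcases isComp_cases hc with ⟨c, rfl, hs⟩ | ⟨a, c, rfl, hs⟩
    · exact ih hs hx.1
    · exact ih hs hx.2

end Cube
section Bar

theorem barD_lof {n : ℕ} (c : CompIdx n) (x : ↥(TP k V n)) :
    barD k V n (DirectSum.lof k (CompIdx n) (fun _ => ↥(TP k V n)) c x) =
      ∑ i : Fin (c.1.length - 1), ((-1 : k) ^ (i : ℕ)) •
        DirectSum.lof k (CompIdx n) (fun _ => ↥(TP k V n)) (mergeIdx c i) x := by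
  simp [barD, DirectSum.toModule_lof]

/-- The projection to the compositions of length `s`. -/
def lengthProj (n s : ℕ) :
    (⨁ _c : CompIdx n, ↥(TP k V n)) →ₗ[k] (⨁ _c : CompIdx n, ↥(TP k V n)) :=
  DirectSum.toModule k _ _ fun c =>
    if c.1.length = s then DirectSum.lof k (CompIdx n) (fun _ => ↥(TP k V n)) c else 0

theorem lengthProj_lof {n : ℕ} (s : ℕ) (c : CompIdx n) (x : ↥(TP k V n)) :
    lengthProj k V n s (DirectSum.lof k (CompIdx n) (fun _ => ↥(TP k V n)) c x) =
      if c.1.length = s then DirectSum.lof k (CompIdx n) (fun _ => ↥(TP k V n)) c x else 0 := by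
  rw [lengthProj, DirectSum.toModule_lof]
  split_ifs <;> rfl

theorem lof_mem_barL {n : ℕ} (c : CompIdx n) (x : ↥(TP k V n)) :
    DirectSum.lof k (CompIdx n) (fun _ => ↥(TP k V n)) c x ∈ barL k V n c.1.length :=
  le_iSup₂ (f := fun (c' : CompIdx n) (_ : c'.1.length = c.1.length) =>
    Submodule.map (DirectSum.lof k (CompIdx n) (fun _ => ↥(TP k V n)) c') ⊤) c rfl
    (Submodule.mem_map_of_mem trivial)

theorem mem_of_forall_lof_mem {n : ℕ} {P : Submodule k (⨁ _c : CompIdx n, ↥(TP k V n))}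
    (h : ∀ c x, DirectSum.lof k (CompIdx n) (fun _ => ↥(TP k V n)) c x ∈ P)
    (b : ⨁ _c : CompIdx n, ↥(TP k V n)) : b ∈ P := by
  induction b using DirectSum.induction_on with
  | zero => exact zero_mem _
  | of c x => exact h c x
  | add b b' hb hb' => exact add_mem hb hb'

theorem lengthProj_mem_barL {n : ℕ} (s : ℕ) (b : ⨁ _c : CompIdx n, ↥(TP k V n)) :
    lengthProj k V n s b ∈ barL k V n s := by
  refine mem_of_forall_lof_mem k V (P := (barL k V n s).comap (lengthProj k V n s))
    (fun c x => ?_) b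
  rw [Submodule.mem_comap, lengthProj_lof]
  split_ifs with h
  · exact h ▸ lof_mem_barL k V c x
  · exact zero_mem _

theorem lengthProj_eq_self {n s : ℕ} {b : ⨁ _c : CompIdx n, ↥(TP k V n)}
    (hb : b ∈ barL k V n s) : lengthProj k V n s b = b := by
  have : barL k V n s ≤ LinearMap.eqLocus (lengthProj k V n s) LinearMap.id := by
    refine iSup₂_le fun c hc => Submodule.map_le_iff_le_comap.2 fun x _ => ?_
    rw [Submodule.mem_comap, LinearMap.mem_eqLocus, lengthProj_lof, if_pos hc]
    rfl
  exact this hb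

theorem lengthProj_barD {n : ℕ} (s : ℕ) (b : ⨁ _c : CompIdx n, ↥(TP k V n)) :
    lengthProj k V n s (barD k V n b) = barD k V n (lengthProj k V n (s + 1) b) := by
  refine mem_of_forall_lof_mem k V (P := LinearMap.eqLocus (lengthProj k V n s ∘ₗ barD k V n)
    (barD k V n ∘ₗ lengthProj k V n (s + 1))) (fun c x => ?_) b
  rw [LinearMap.mem_eqLocus, LinearMap.comp_apply, LinearMap.comp_apply, lengthProj_lof, barD_lof,
    map_sum]
  have e : ∀ i : Fin (c.1.length - 1), (mergeIdx c i).1.length = s ↔ c.1.length = s + 1 := by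
    intro i
    have : (mergeIdx c i).1.length + 1 = c.1.length := length_mergeList (c := c.1) i.isLt
    omega
  simp only [map_smul, lengthProj_lof, e]
  split_ifs
  · rw [barD_lof]
  · simp

theorem barD_lengthProj_zero {n : ℕ} (b : ⨁ _c : CompIdx n, ↥(TP k V n)) :
    barD k V n (lengthProj k V n 0 b) = 0 := by
  refine mem_of_forall_lof_mem k V (P := LinearMap.ker (barD k V n ∘ₗ lengthProj k V n 0))
    (fun c x => ?_) b
  rw [LinearMap.mem_ker, LinearMap.comp_apply, lengthProj_lof]
  split_ifs with h
  · rw [barD_lof]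
    refine Finset.sum_eq_zero fun i _ => ?_
    have := i.isLt
    omega
  · exact map_zero _

theorem barD_mem_barL {n s : ℕ} {b : ⨁ _c : CompIdx n, ↥(TP k V n)}
    (hb : b ∈ barL k V n (s + 1)) : barD k V n b ∈ barL k V n s := by
  rw [← lengthProj_eq_self k V hb, ← lengthProj_barD]
  exact lengthProj_mem_barL k V s _

theorem sum_lengthProj {n : ℕ} (b : ⨁ _c : CompIdx n, ↥(TP k V n)) :
    ∑ s ∈ Finset.range (n + 1), lengthProj k V n s b = b := by
  have := mem_of_forall_lof_mem k V (P := LinearMap.eqLocus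
    (∑ s ∈ Finset.range (n + 1), lengthProj k V n s) LinearMap.id) (fun c x => ?_) b
  · simpa using this
  · have := length_le_of_isComp c.2
    rw [LinearMap.mem_eqLocus, LinearMap.sum_apply]
    simp only [lengthProj_lof, Finset.sum_ite_eq, Finset.mem_range]
    rw [if_pos (by omega)]
    rfl

theorem barL_self (n : ℕ) : barL k V n n = Submodule.map
    (DirectSum.lof k (CompIdx n) (fun _ => ↥(TP k V n)) (allOnes n)) ⊤ := by
  apply le_antisymm
  · refine iSup₂_le fun c hc => ?_
    rw [eq_allOnes c hc]
  · exact le_iSup₂_of_le (allOnes n) (by simp [allOnes]) le_rfl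

theorem barL_succ_self (n : ℕ) : barL k V n (n + 1) = ⊥ := by
  refine le_bot_iff.1 (iSup₂_le fun c hc => ?_)
  have := length_le_of_isComp c.2
  omega

theorem lof_mem_barN {n : ℕ} {c : CompIdx n} {x : ↥(TP k V n)}
    (hx : x ∈ castTP k V c.2.2 (Qden k V R c.1)) :
    DirectSum.lof k (CompIdx n) (fun _ => ↥(TP k V n)) c x ∈ barN k V R n :=
  le_iSup (fun c : CompIdx n => Submodule.map
    (DirectSum.lof k (CompIdx n) (fun _ => ↥(TP k V n)) c) (castTP k V c.2.2 (Qden k V R c.1))) c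
    (Submodule.mem_map_of_mem hx)

theorem lengthProj_mem_barN {n : ℕ} (s : ℕ) {b : ⨁ _c : CompIdx n, ↥(TP k V n)}
    (hb : b ∈ barN k V R n) : lengthProj k V n s b ∈ barN k V R n := by
  have : barN k V R n ≤ (barN k V R n).comap (lengthProj k V n s) := by
    refine iSup_le fun c => Submodule.map_le_iff_le_comap.2 fun x hx => ?_
    rw [Submodule.mem_comap, Submodule.mem_comap, lengthProj_lof]
    split_ifs
    · exact lof_mem_barN k V R hx
    · exact zero_mem _
  exact this hb

/-- The bar complex is acyclic away from the top degree, all degrees being considered at once. -/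
def BarAcyclic (n : ℕ) : Prop :=
  ∀ b, barD k V n b ∈ barN k V R n → ∃ y x, b - barD k V n y -
    DirectSum.lof k (CompIdx n) (fun _ => ↥(TP k V n)) (allOnes n) x ∈ barN k V R n

theorem barAcyclic_iff {n : ℕ}
    (hN : ∀ b ∈ barN k V R n, barD k V n b ∈ barN k V R n)
    (hD : ∀ b, barD k V n (barD k V n b) = 0) :
    BarAcyclic k V R n ↔ ∀ s : ℕ, s ≠ n →
      barL k V n s ⊓ Submodule.comap (barD k V n) (barN k V R n) =
        Submodule.map (barD k V n) (barL k V n (s + 1)) ⊔ (barN k V R n ⊓ barL k V n s) := by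
  constructor
  · intro h s hs
    apply le_antisymm
    · rintro b ⟨hb, hb'⟩
      obtain ⟨y, x, hyx⟩ := h b hb'
      have := lengthProj_mem_barN k V R s hyx
      rw [map_sub, map_sub, lengthProj_lof, if_neg (by simpa [allOnes] using hs.symm), sub_zero,
        lengthProj_barD, lengthProj_eq_self k V hb] at this
      have hy := lengthProj_mem_barL k V (s + 1) y
      exact Submodule.mem_sup.2 ⟨_, Submodule.mem_map_of_mem hy, _,
        ⟨this, sub_mem hb (barD_mem_barL k V hy)⟩, by abel⟩
    · refine sup_le ?_ fun b hb => ⟨hb.2, hN b hb.1⟩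
      rintro _ ⟨y, hy, rfl⟩
      refine ⟨barD_mem_barL k V hy, ?_⟩
      rw [SetLike.mem_coe, Submodule.mem_comap, hD]
      exact zero_mem _
  · intro h b hb
    let P := LinearMap.range (barD k V n) ⊔ (LinearMap.range
      (DirectSum.lof k (CompIdx n) (fun _ => ↥(TP k V n)) (allOnes n)) ⊔ barN k V R n)
    have hs : ∀ s, barD k V n (lengthProj k V n s b) ∈ barN k V R n := by
      rintro (_ | s)
      · rw [barD_lengthProj_zero]
        exact zero_mem _
      · rw [← lengthProj_barD]
        exact lengthProj_mem_barN k V R s hb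
    have hP : b ∈ P := by
      rw [← sum_lengthProj k V b]
      refine sum_mem fun s _ => ?_
      have hL := lengthProj_mem_barL k V s b
      by_cases hsn : s = n
      · subst hsn
        rw [barL_self, Submodule.map_top] at hL
        exact Submodule.mem_sup_right (Submodule.mem_sup_left hL)
      · have := (h s hsn).le ⟨hL, hs s⟩
        exact (sup_le_sup LinearMap.map_le_range (inf_le_left.trans le_sup_right) :
          _ ≤ P) this
    obtain ⟨_, ⟨y, rfl⟩, _, hw, rfl⟩ := Submodule.mem_sup.1 hP
    obtain ⟨_, ⟨x, rfl⟩, z, hz, rfl⟩ := Submodule.mem_sup.1 hw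
    exact ⟨y, x, by simpa [add_sub_cancel_left] using hz⟩

end Bar

section Comparison

variable {m : ℕ}

theorem isComp_range' (c : CompIdx (m + 1)) :
    (∀ d ∈ c.1, 1 ≤ d) ∧ c.1.sum = (List.range' 0 m).length + 1 := by
  rw [List.length_range']
  exact c.2

variable (m) in
/-- The comparison of the weight `m + 1` bar complex with the cube complex. -/
def barToCube :
    (⨁ _c : CompIdx (m + 1), ↥(TP k V (m + 1))) →ₗ[k]
      Cube ↥(TP k V (m + 1)) (List.range' 0 m) :=
  DirectSum.toModule k _ _ fun c => Cube.ins k ↥(TP k V (m + 1)) (List.range' 0 m) c.1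

theorem barToCube_lof (c : CompIdx (m + 1)) (x : ↥(TP k V (m + 1))) :
    barToCube k V m (DirectSum.lof k (CompIdx (m + 1)) (fun _ => ↥(TP k V (m + 1))) c x) =
      Cube.ins k ↥(TP k V (m + 1)) (List.range' 0 m) c.1 x :=
  DirectSum.toModule_lof _ _ _

theorem barToCube_allOnes (x : ↥(TP k V (m + 1))) :
    barToCube k V m (DirectSum.lof k (CompIdx (m + 1)) (fun _ => ↥(TP k V (m + 1)))
      (allOnes (m + 1)) x) = Cube.init k _ _ x := by
  rw [barToCube_lof, ← Cube.ins_replicate, List.length_range']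
  rfl

theorem barToCube_surjective : Function.Surjective (barToCube k V m) := by
  rw [← LinearMap.range_eq_top]
  refine Cube.eq_top_of_ins_mem _ fun c hc x => ?_
  rw [List.length_range'] at hc
  exact ⟨_, barToCube_lof k V ⟨c, hc⟩ x⟩

theorem barToCube_barD (b : ⨁ _c : CompIdx (m + 1), ↥(TP k V (m + 1))) :
    barToCube k V m (barD k V (m + 1) b) = Cube.diff k _ _ (barToCube k V m b) := by
  refine mem_of_forall_lof_mem k V (P := LinearMap.eqLocus (barToCube k V m ∘ₗ barD k V (m + 1))
    (Cube.diff k _ _ ∘ₗ barToCube k V m)) (fun c x => ?_) b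
  rw [LinearMap.mem_eqLocus, LinearMap.comp_apply, LinearMap.comp_apply, barD_lof, barToCube_lof,
    Cube.diff_ins (isComp_range' c), Finset.sum_range, map_sum]
  simp only [map_smul, barToCube_lof]
  rfl

theorem proj_barToCube (c : CompIdx (m + 1)) (b : ⨁ _c : CompIdx (m + 1), ↥(TP k V (m + 1))) :
    Cube.proj k _ _ c.1 (barToCube k V m b) = b c := by
  refine mem_of_forall_lof_mem k V (P := LinearMap.eqLocus (Cube.proj k _ _ c.1 ∘ₗ barToCube k V m)
    (DirectSum.component k _ _ c)) (fun c' x => ?_) b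
  rw [LinearMap.mem_eqLocus, LinearMap.comp_apply, barToCube_lof,
    Cube.proj_ins (isComp_range' c) (isComp_range' c'), DirectSum.component.of]
  by_cases h : c = c'
  · subst h
    simp
  · rw [if_neg fun h' => h (Subtype.ext h'), dif_neg (Ne.symm h)]

theorem barToCube_mem_den (b : ⨁ _c : CompIdx (m + 1), ↥(TP k V (m + 1))) :
    barToCube k V m b ∈ Cube.den (relAt k V R (m + 1)) ⊥ (List.range' 0 m) ↔
      b ∈ barN k V R (m + 1) := by
  constructor
  · intro hb
    classical
    rw [← DirectSum.sum_support_of b]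
    refine sum_mem fun c _ => lof_mem_barN k V R ?_
    rw [castTP_Qden k V R c.1 c.2.1 c.2.2, ← proj_barToCube k V c b]
    exact Cube.proj_mem_blockDen (isComp_range' c) hb
  · intro hb
    have : barN k V R (m + 1) ≤ (Cube.den (relAt k V R (m + 1)) ⊥ (List.range' 0 m)).comap
        (barToCube k V m) := by
      refine iSup_le fun c => Submodule.map_le_iff_le_comap.2 fun x hx => ?_
      rw [castTP_Qden k V R c.1 c.2.1 c.2.2] at hx
      rw [Submodule.mem_comap, Submodule.mem_comap, barToCube_lof]
      exact Cube.ins_mem_den (isComp_range' c) hx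
    exact this hb

theorem barToCube_injective : Function.Injective (barToCube k V m) := by
  intro b b' h
  refine DFinsupp.ext fun c => ?_
  rw [← proj_barToCube, h, proj_barToCube]

theorem barAcyclic_iff_weightAcyclic :
    BarAcyclic k V R (m + 1) ↔ WeightAcyclic k V R (m + 1) := by
  have : WeightAcyclic k V R (m + 1) ↔
      Cube.Acyclic (relAt k V R (m + 1)) ⊥ (List.range' 0 m) := by
    rw [WeightAcyclic, Nat.add_sub_cancel, ← List.range_eq_range']
    exact ⟨fun h => h.perm (List.reverse_perm _), fun h => h.perm (List.reverse_perm _).symm⟩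
  rw [this, BarAcyclic, Cube.Acyclic, (barToCube_surjective k V).forall]
  refine forall_congr' fun b => ?_
  simp only [(barToCube_surjective k V).exists, ← barToCube_barD, ← barToCube_allOnes, ← map_sub,
    barToCube_mem_den]

theorem barD_mem_barN (b : ⨁ _c : CompIdx (m + 1), ↥(TP k V (m + 1)))
    (hb : b ∈ barN k V R (m + 1)) : barD k V (m + 1) b ∈ barN k V R (m + 1) := by
  rw [← barToCube_mem_den, barToCube_barD]
  exact Cube.diff_mem_den ((barToCube_mem_den k V R b).2 hb)

theorem barD_barD (b : ⨁ _c : CompIdx (m + 1), ↥(TP k V (m + 1))) :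
    barD k V (m + 1) (barD k V (m + 1) b) = 0 := by
  apply barToCube_injective
  rw [barToCube_barD, barToCube_barD, Cube.diff_diff, map_zero]

theorem barN_inf_barL_self : barN k V R (m + 1) ⊓ barL k V (m + 1) (m + 1) = ⊥ := by
  rw [barL_self, eq_bot_iff]
  rintro _ ⟨hN, x, -, rfl⟩
  rw [SetLike.mem_coe, ← barToCube_mem_den, barToCube_allOnes, Cube.init_mem_den,
    Submodule.mem_bot] at hN
  rw [hN, map_zero]
  exact zero_mem _

theorem barL_self_inf_comap : barL k V (m + 1) (m + 1) ⊓
    Submodule.comap (barD k V (m + 1)) (barN k V R (m + 1)) = dualTop k V R (m + 1) := by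
  have : ∀ x, barD k V (m + 1) (DirectSum.lof k (CompIdx (m + 1)) (fun _ => ↥(TP k V (m + 1)))
      (allOnes (m + 1)) x) ∈ barN k V R (m + 1) ↔ x ∈ Dual k V R (m + 1) := by
    intro x
    rw [← barToCube_mem_den, barToCube_barD, barToCube_allOnes, Cube.diff_init_mem_den, Dual_eq]
    simp [Submodule.mem_iInf, ← List.range_eq_range']
  rw [barL_self, dualTop]
  ext b
  constructor
  · rintro ⟨⟨x, -, rfl⟩, hx⟩
    exact Submodule.mem_map_of_mem ((this x).1 hx)
  · rintro ⟨x, hx, rfl⟩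
    exact ⟨Submodule.mem_map_of_mem trivial, (this x).2 hx⟩

end Comparison
/-- **The Koszul dual as bar homology.**  `A = T(V)/(R)` is Koszul (all its Koszul complexes are
exact) if and only if, for every `ρ ≥ 1`, the homology of the weight-`ρ` subcomplex
`B̄(A)^{(ρ)}` of the reduced bar complex is concentrated in homological degree `ρ`, where it is
`A^¡_ρ` (via the inclusion of `A^¡_ρ`, placed in degree `ρ`, into `B̄(A)^{(ρ)}`): in the model
above, for `s ≠ ρ` the degree-`s` cycles modulo `barN` are exactly the degree-`s` boundaries
modulo `barN`, while in degree `ρ` they are `A^¡_ρ ⊕ boundaries` modulo `barN`. -/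
theorem statement7 (R : Submodule k ↥(TP k V 2)) :
    IsKoszul k V R ↔
      ∀ ρ ≥ 1,
        (∀ s : ℕ, s ≠ ρ →
          barL k V ρ s ⊓ Submodule.comap (barD k V ρ) (barN k V R ρ) =
            Submodule.map (barD k V ρ) (barL k V ρ (s + 1)) ⊔ (barN k V R ρ ⊓ barL k V ρ s)) ∧
        (barL k V ρ ρ ⊓ Submodule.comap (barD k V ρ) (barN k V R ρ) =
          dualTop k V R ρ ⊔
            (Submodule.map (barD k V ρ) (barL k V ρ (ρ + 1)) ⊔ (barN k V R ρ ⊓ barL k V ρ ρ))) ∧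
        (dualTop k V R ρ ⊓
            (Submodule.map (barD k V ρ) (barL k V ρ (ρ + 1)) ⊔ (barN k V R ρ ⊓ barL k V ρ ρ)) =
          ⊥) := by
  rw [isKoszul_iff_weightAcyclic]
  have h : ∀ m, WeightAcyclic k V R (m + 1) ↔ ∀ s : ℕ, s ≠ m + 1 →
      barL k V (m + 1) s ⊓ Submodule.comap (barD k V (m + 1)) (barN k V R (m + 1)) =
        Submodule.map (barD k V (m + 1)) (barL k V (m + 1) (s + 1)) ⊔
          (barN k V R (m + 1) ⊓ barL k V (m + 1) s) := fun m => by
    rw [← barAcyclic_iff_weightAcyclic, barAcyclic_iff k V R (barD_mem_barN k V R)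
      (barD_barD k V)]
  constructor
  · intro hK n hn
    obtain ⟨m, rfl⟩ : ∃ m, n = m + 1 := ⟨n - 1, by omega⟩
    rw [barL_self_inf_comap, barL_succ_self, barN_inf_barL_self]
    exact ⟨(h m).1 (hK m), by simp, by simp⟩
  · exact fun hB m => (h m).2 (hB (m + 1) (by omega)).1

end Quadratic
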